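/- arXiv:2206.15061 — 10 statements merged into one kernel-verified Lean document; each statement's English description precedes it below -/
import Mathlib

section
/- Let X be a reflexive Banach space, let H : X → ℝ and K : X → ℝ be two continuously Gâteaux differentiable functionals such that H is coercive (H(u) → +∞ as ‖u‖ → +∞) and sequentially weakly lower semi-continuous, K is sequentially weakly upper semi-continuous, and inf_X H = H(0) = K(0) = 0. Let r > 0 and suppose sup { K(u) : u ∈ X, 0 ≤ H(u) ≤ r } > 0. Then for every λ with 0 < λ < r / sup { K(u) : 0 ≤ H(u) ≤ r }, the functional J_λ := H − λK has a critical point u_λ with H(u_λ) ∈ [0, r] satisfying J_λ(u_λ) ≤ J_λ(v) for all v ∈ X with H(v) ∈ [0, r]. -/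
open Filter Topology

/-- Limits along weakly convergent families stay in a closed convex set. -/
theorem mem_of_tendsto_dual_apply {X ι : Type*} [NormedAddCommGroup X] [NormedSpace ℝ X]
    {s : Set X} (hs : Convex ℝ s) (hc : IsClosed s) {l : Filter ι} [l.NeBot] {u : ι → X} {x : X}
    (hu : ∀ i, u i ∈ s) (hx : ∀ f : X →L[ℝ] ℝ, Tendsto (fun i => f (u i)) l (𝓝 (f x))) :
    x ∈ s := by
  by_contra hxs
  obtain ⟨f, a, hlt, hgt⟩ := geometric_hahn_banach_closed_point hs hc hxs
  exact hgt.not_ge (le_of_tendsto' (hx f) fun i => (hlt _ (hu i)).le)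

/-- In a reflexive space, bounded families converge weakly along every ultrafilter. -/
theorem exists_tendsto_dual_apply_ultrafilter {X ι : Type*} [NormedAddCommGroup X]
    [NormedSpace ℝ X] (hrefl : Function.Surjective (NormedSpace.inclusionInDoubleDual ℝ X))
    {u : ι → X} {C : ℝ} (hu : ∀ i, ‖u i‖ ≤ C) (U : Ultrafilter ι) :
    ∃ x : X, ∀ f : X →L[ℝ] ℝ, Tendsto (fun i => f (u i)) U (𝓝 (f x)) := by
  let g : ι → WeakDual ℝ (StrongDual ℝ X) := fun i =>
    StrongDual.toWeakDual (NormedSpace.inclusionInDoubleDual ℝ X (u i))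
  have hg : ∀ i, g i ∈ WeakDual.toStrongDual ⁻¹'
      Metric.closedBall (0 : StrongDual ℝ (StrongDual ℝ X)) C := fun i =>
    (mem_closedBall_zero_iff (E := StrongDual ℝ (StrongDual ℝ X))).2 <|
      (NormedSpace.double_dual_bound ℝ X (u i)).trans (hu i)
  obtain ⟨φ, -, hφ⟩ := (WeakDual.isCompact_closedBall (𝕜 := ℝ)
    (0 : StrongDual ℝ (StrongDual ℝ X)) C).ultrafilter_le_nhds (U.map g)
    (le_principal_iff.2 <| Filter.mem_map.2 <| Filter.Eventually.of_forall hg)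
  obtain ⟨x, hx⟩ := hrefl (WeakDual.toStrongDual φ)
  refine ⟨x, fun f => ?_⟩
  have h := ((WeakDual.eval_continuous f).tendsto φ).comp (show Tendsto g U (𝓝 φ) from hφ)
  have hfx : φ f = f x := by
    rw [← NormedSpace.dual_def ℝ X x f, hx]
    rfl
  rw [hfx] at h
  exact h

/-- A separable subspace of a normed space admits countably many functionals separating its
points. -/
theorem exists_seq_dual_separating {X : Type*} [NormedAddCommGroup X] [NormedSpace ℝ X]
    {Y : Submodule ℝ X} (hY : TopologicalSpace.IsSeparable (Y : Set X)) :
    ∃ f : ℕ → X →L[ℝ] ℝ, (∀ k, ‖f k‖ ≤ 1) ∧ ∀ y ∈ Y, (∀ k, f k y = 0) → y = 0 := by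
  obtain ⟨c, hc, hYc⟩ := hY
  have hne : c.Nonempty := closure_nonempty_iff.1 ⟨0, hYc Y.zero_mem⟩
  obtain ⟨d, rfl⟩ := hc.exists_eq_range hne
  choose f hf hfd using fun k => exists_dual_vector'' ℝ (d k)
  refine ⟨f, hf, fun y hy h0 => ?_⟩
  by_contra hy0
  have hpos : 0 < ‖y‖ / 2 := half_pos (norm_pos_iff.2 hy0)
  obtain ⟨_, ⟨k, rfl⟩, hk⟩ := Metric.mem_closure_iff.1 (hYc hy) _ hpos
  rw [dist_eq_norm] at hk
  have h1 : ‖d k‖ ≤ ‖y - d k‖ := by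
    have h2 := (f k).le_of_opNorm_le (hf k) (y - d k)
    rw [map_sub, h0 k, hfd k] at h2
    simpa using h2
  have h3 := norm_sub_norm_le y (d k)
  linarith

/-- Bounded sequences in a reflexive space have weakly convergent subsequences. -/
theorem exists_subseq_tendsto_dual_apply {X : Type*} [NormedAddCommGroup X] [NormedSpace ℝ X]
    (hrefl : Function.Surjective (NormedSpace.inclusionInDoubleDual ℝ X))
    {u : ℕ → X} {C : ℝ} (hu : ∀ n, ‖u n‖ ≤ C) :
    ∃ (x : X) (φ : ℕ → ℕ), StrictMono φ ∧
      ∀ f : X →L[ℝ] ℝ, Tendsto (fun n => f (u (φ n))) atTop (𝓝 (f x)) := by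
  let Y := (Submodule.span ℝ (Set.range u)).topologicalClosure
  have hY : TopologicalSpace.IsSeparable (Y : Set X) :=
    (Set.countable_range u).isSeparable.span.closure
  have huY : ∀ n, u n ∈ Y := fun n =>
    Submodule.le_topologicalClosure _ (Submodule.subset_span ⟨n, rfl⟩)
  obtain ⟨F, hF, hsep⟩ := exists_seq_dual_separating hY
  have hcomp : IsCompact (Set.univ.pi fun _ : ℕ => Set.Icc (-C) C) :=
    isCompact_univ_pi fun _ => isCompact_Icc
  obtain ⟨a, -, φ, hφ, ha⟩ := hcomp.isSeqCompact (x := fun n k => F k (u n)) fun n k _ =>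
    abs_le.1 <| ((F k).le_of_opNorm_le (hF k) (u n)).trans (by simpa using hu n)
  have hak : ∀ k, Tendsto (fun n => F k (u (φ n))) atTop (𝓝 (a k)) := tendsto_pi_nhds.1 ha
  choose x hx using exists_tendsto_dual_apply_ultrafilter hrefl (fun n => hu (φ n))
  have hxY : ∀ U, x U ∈ Y := fun U =>
    mem_of_tendsto_dual_apply Y.convex (Submodule.isClosed_topologicalClosure _)
      (fun n => huY (φ n)) (hx U)
  have hxa : ∀ U : Ultrafilter ℕ, ↑U ≤ (atTop : Filter ℕ) → ∀ k, F k (x U) = a k :=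
    fun U hU k => tendsto_nhds_unique (hx U (F k)) ((hak k).mono_left hU)
  refine ⟨x (Ultrafilter.of atTop), φ, hφ, fun f => ?_⟩
  rw [tendsto_iff_ultrafilter]
  intro U hU
  have heq : x U = x (Ultrafilter.of atTop) := sub_eq_zero.1 <|
    hsep _ (Y.sub_mem (hxY _) (hxY _)) fun k => by
      rw [map_sub, hxa U hU, hxa _ (Ultrafilter.of_le _), sub_self]
  exact heq ▸ hx U f

/-- **Local minimum theorem** (Bonanno–Candito type variational principle).
`X` is a reflexive real Banach space (reflexivity expressed as surjectivity of the
canonical inclusion into the double dual). `H` and `K` are continuously (Gâteaux,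
hence Fréchet) differentiable functionals; `H` is coercive and sequentially weakly
lower semicontinuous, `K` is sequentially weakly upper semicontinuous, and
`inf H = H 0 = K 0 = 0`.  For every `0 < λ < r / sup {K u : H u ∈ [0, r]}` the
functional `J_λ = H - λ K` has a critical point `u` with `H u ∈ [0, r]` minimizing
`J_λ` over `{v : H v ∈ [0, r]}`. -/
theorem stmt_0 {X : Type*} [NormedAddCommGroup X] [NormedSpace ℝ X] [CompleteSpace X]
    (hrefl : Function.Surjective (NormedSpace.inclusionInDoubleDual ℝ X))
    (H K : X → ℝ) (H' K' : X → (X →L[ℝ] ℝ))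
    (hHderiv : ∀ x, HasFDerivAt H (H' x) x)
    (hKderiv : ∀ x, HasFDerivAt K (K' x) x)
    (hH'cont : Continuous H') (hK'cont : Continuous K')
    (hcoercive : Tendsto H (Filter.comap norm Filter.atTop) Filter.atTop)
    (hHwlsc : ∀ (u : ℕ → X) (u₀ : X),
      (∀ f : X →L[ℝ] ℝ, Tendsto (fun n => f (u n)) atTop (𝓝 (f u₀))) →
      H u₀ ≤ Filter.liminf (fun n => H (u n)) atTop)
    (hKwusc : ∀ (u : ℕ → X) (u₀ : X),
      (∀ f : X →L[ℝ] ℝ, Tendsto (fun n => f (u n)) atTop (𝓝 (f u₀))) →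
      Filter.limsup (fun n => K (u n)) atTop ≤ K u₀)
    (hHinf : ∀ x, H 0 ≤ H x) (hH0 : H 0 = 0) (hK0 : K 0 = 0)
    (r : ℝ) (hr : 0 < r)
    (hsup : 0 < sSup (K '' {u | H u ∈ Set.Icc 0 r}))
    (lam : ℝ) (hlam1 : 0 < lam)
    (hlam2 : lam < r / sSup (K '' {u | H u ∈ Set.Icc 0 r})) :
    ∃ u : X, H u ∈ Set.Icc 0 r ∧ H' u = lam • K' u ∧
      ∀ v : X, H v ∈ Set.Icc 0 r → H u - lam * K u ≤ H v - lam * K v := by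
  set S : Set X := {u | H u ∈ Set.Icc 0 r} with hS
  set M := sSup (K '' S)
  have hbdd : BddAbove (K '' S) := by
    by_contra h
    exact hsup.ne' (Real.sSup_of_not_bddAbove h)
  have hKM : ∀ v ∈ S, K v ≤ M := fun v hv => le_csSup hbdd ⟨v, hv, rfl⟩
  have hnonneg : ∀ v, 0 ≤ H v := fun v => hH0 ▸ hHinf v
  have hlamM : lam * M < r := (lt_div_iff₀ hsup).1 hlam2
  have h0S : (0 : X) ∈ S := by simp [hS, hH0, hr.le]
  let J : X → ℝ := fun v => H v - lam * K v
  have hJ0 : J 0 = 0 := by simp [J, hH0, hK0]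
  have hJbdd : BddBelow (J '' S) := by
    refine ⟨-r, ?_⟩
    rintro _ ⟨v, hv, rfl⟩
    have h1 := mul_le_mul_of_nonneg_left (hKM v hv) hlam1.le
    have h2 := hnonneg v
    simp only [J]
    linarith
  obtain ⟨C, hC⟩ : ∃ C, ∀ v ∈ S, ‖v‖ ≤ C := by
    obtain ⟨C, hC⟩ := (eventually_atTop.1 <|
      eventually_comap.1 (hcoercive.eventually (eventually_gt_atTop r)))
    refine ⟨C, fun v hv => ?_⟩
    by_contra! h
    exact (hC _ h.le v rfl).not_ge hv.2
  obtain ⟨w, hwanti, hwlim, hwmem⟩ := exists_seq_tendsto_sInf (Set.Nonempty.image J ⟨0, h0S⟩) hJbdd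
  choose u huS huw using hwmem
  have hKlow : ∀ n, -w 0 / lam ≤ K (u n) := fun n => by
    rw [div_le_iff₀ hlam1]
    have h1 := hnonneg (u n)
    have h2 : H (u n) - lam * K (u n) ≤ w 0 := (huw n).le.trans (hwanti n.zero_le)
    linarith
  obtain ⟨x, φ, hφ, hx⟩ := exists_subseq_tendsto_dual_apply hrefl fun n => hC _ (huS n)
  obtain ⟨⟨a, b⟩, ⟨ha, -⟩, ψ, hψ, hab⟩ :=
    ((isCompact_Icc (a := (0 : ℝ)) (b := r)).prod
      (isCompact_Icc (a := -w 0 / lam) (b := M))).isSeqCompact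
      (x := fun n => (H (u (φ n)), K (u (φ n))))
      fun n => ⟨huS (φ n), hKlow _, hKM _ (huS _)⟩
  have hHa : Tendsto (fun n => H (u (φ (ψ n)))) atTop (𝓝 a) := hab.fst_nhds
  have hKb : Tendsto (fun n => K (u (φ (ψ n)))) atTop (𝓝 b) := hab.snd_nhds
  have hxψ : ∀ f : X →L[ℝ] ℝ, Tendsto (fun n => f (u (φ (ψ n)))) atTop (𝓝 (f x)) :=
    fun f => (hx f).comp hψ.tendsto_atTop
  have hxa : H x ≤ a := hHa.liminf_eq ▸ hHwlsc _ x hxψ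
  have hxb : b ≤ K x := hKb.limsup_eq ▸ hKwusc _ x hxψ
  have hxS : x ∈ S := ⟨hnonneg x, hxa.trans ha.2⟩
  have hinf : a - lam * b = sInf (J '' S) := by
    refine tendsto_nhds_unique (hHa.sub (hKb.const_mul lam)) ?_
    refine (hwlim.comp (hφ.comp hψ).tendsto_atTop).congr fun n => ?_
    exact (huw _).symm
  have hmin : ∀ v ∈ S, J x ≤ J v := fun v hv => by
    have h1 : sInf (J '' S) ≤ J v := csInf_le hJbdd ⟨v, hv, rfl⟩
    have h2 := mul_le_mul_of_nonneg_left hxb hlam1.le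
    have h3 : J x ≤ a - lam * b := by
      simp only [J]
      linarith
    exact h3.trans (hinf.le.trans h1)
  refine ⟨x, hxS, ?_, hmin⟩
  have hHr : H x < r := by
    have h1 : H x - lam * K x ≤ 0 := hJ0 ▸ hmin 0 h0S
    have h2 := mul_le_mul_of_nonneg_left (hKM x hxS) hlam1.le
    linarith
  have hloc : IsLocalMin J x := by
    filter_upwards [(hHderiv x).continuousAt.eventually (gt_mem_nhds hHr)] with v hv
    exact hmin v ⟨hnonneg v, hv.le⟩
  exact sub_eq_zero.1 (hloc.hasFDerivAt_eq_zero ((hHderiv x).sub ((hKderiv x).const_mul lam)))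
end

section
/- Let Ω ⊆ ℝ^N be a bounded measurable set, let p, r > 1, and let u ∈ L^p(Ω). For k ∈ ℝ set Ω_k := { x ∈ Ω : u(x) ≥ k }. Suppose there exist c, K > 0 such that for all k ≥ K: ( ∫_{Ω_k} (u − k)^p dx )^{1/r} ≤ c [ ∫_{Ω_k} (u − k)^p dx + k^p |Ω_k| ], where |Ω_k| denotes the Lebesgue measure of Ω_k. Then there exists M > 0 such that u ≤ M almost everywhere in Ω. -/
open MeasureTheory

open Filter Topology

/-- **Fast geometric convergence.** A nonnegative sequence with `F (n + 1) ≤ (C * B ^ n * F n) ^ r`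
and `1 < r` tends to zero as soon as its first term is small enough. -/
theorem exists_forall_le_tendsto_zero_of_le_rpow {B C r : ℝ} (hB : 1 < B) (hC : 0 < C)
    (hr : 1 < r) :
    ∃ δ : ℝ, 0 < δ ∧ ∀ F : ℕ → ℝ, (∀ n, 0 ≤ F n) →
      (∀ n, F (n + 1) ≤ (C * B ^ n * F n) ^ r) → F 0 ≤ δ → Tendsto F atTop (𝓝 0) := by
  have hr0 : 0 < r - 1 := sub_pos.2 hr
  have hB0 : 0 < B := one_pos.trans hB
  set q : ℝ := B ^ (-(r / (r - 1))) with hq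
  have hq0 : 0 < q := Real.rpow_pos_of_pos hB0 _
  have hq1 : q < 1 := Real.rpow_lt_one_of_one_lt_of_neg hB (by
    have : 0 < r / (r - 1) := by positivity
    linarith)
  have hBq : (B * q) ^ r = q := by
    rw [hq]
    nth_rewrite 1 [← Real.rpow_one B]
    rw [← Real.rpow_add hB0, ← Real.rpow_mul hB0.le]
    congr 1
    field_simp
    ring
  set δ : ℝ := (q * C ^ (-r)) ^ (1 / (r - 1)) with hδ
  have hδ0 : 0 < δ := by positivity
  have hCδ : (C * δ) ^ r = δ * q := by
    have h1 : δ ^ (r - 1) = q * C ^ (-r) := by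
      rw [hδ, ← Real.rpow_mul (by positivity), one_div_mul_cancel hr0.ne', Real.rpow_one]
    have h2 : δ ^ r = δ * δ ^ (r - 1) := by
      nth_rewrite 2 [← Real.rpow_one δ]
      rw [← Real.rpow_add hδ0]
      congr 1
      ring
    have h3 : C ^ r * C ^ (-r) = 1 := by
      rw [← Real.rpow_add hC]
      simp
    rw [Real.mul_rpow hC.le hδ0.le, h2, h1]
    linear_combination δ * q * h3
  refine ⟨δ, hδ0, fun F hF hstep h0 => ?_⟩
  have hle : ∀ n, F n ≤ δ * q ^ n := by
    intro n
    induction n with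
    | zero => simpa using h0
    | succ n ih =>
      have hFn := hF n
      calc F (n + 1) ≤ (C * B ^ n * F n) ^ r := hstep n
        _ ≤ (C * B ^ n * (δ * q ^ n)) ^ r := by gcongr
        _ = ((C * δ) * (B * q) ^ n) ^ r := by
            congr 1
            rw [mul_pow]
            ring
        _ = δ * q ^ (n + 1) := by
            rw [Real.mul_rpow (by positivity) (by positivity), hCδ,
              ← Real.rpow_pow_comm (by positivity), hBq]
            ring
  refine squeeze_zero hF hle ?_
  simpa using (tendsto_pow_atTop_nhds_zero_of_lt_one hq0.le hq1).const_mul δ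

section Superlevel

variable {α : Type*} [MeasurableSpace α] {μ : Measure α} {u : α → ℝ} {p : ℝ}

theorem setIntegral_sub_rpow_nonneg (hu : Measurable u) (k : ℝ) :
    0 ≤ ∫ x in {x | k ≤ u x}, (u x - k) ^ p ∂μ :=
  setIntegral_nonneg (measurableSet_le measurable_const hu)
    fun _ hx => Real.rpow_nonneg (sub_nonneg.2 hx) p

theorem integrableOn_sub_rpow (hp : 0 ≤ p) (hu : Measurable u)
    (hLp : Integrable (fun x => |u x| ^ p) μ) {k : ℝ} (hk : 0 ≤ k) :
    IntegrableOn (fun x => (u x - k) ^ p) {x | k ≤ u x} μ := by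
  refine hLp.integrableOn.mono' (by fun_prop) ?_
  refine ae_restrict_of_forall_mem (measurableSet_le measurable_const hu) fun x hx => ?_
  have hx' : k ≤ u x := hx
  rw [Real.norm_of_nonneg (Real.rpow_nonneg (sub_nonneg.2 hx') p)]
  exact Real.rpow_le_rpow (sub_nonneg.2 hx') (by linarith [le_abs_self (u x)]) hp

theorem setIntegral_sub_rpow_antitone (hp : 0 ≤ p) (hu : Measurable u)
    (hLp : Integrable (fun x => |u x| ^ p) μ) {h k : ℝ} (hh : 0 ≤ h) (hhk : h ≤ k) :
    ∫ x in {x | k ≤ u x}, (u x - k) ^ p ∂μ ≤ ∫ x in {x | h ≤ u x}, (u x - h) ^ p ∂μ := by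
  have hint := integrableOn_sub_rpow hp hu hLp hh
  have hsub : {x | k ≤ u x} ⊆ {x | h ≤ u x} := fun x hx => hhk.trans hx
  calc ∫ x in {x | k ≤ u x}, (u x - k) ^ p ∂μ
      ≤ ∫ x in {x | k ≤ u x}, (u x - h) ^ p ∂μ :=
        setIntegral_mono_on (integrableOn_sub_rpow hp hu hLp (hh.trans hhk)) (hint.mono_set hsub)
          (measurableSet_le measurable_const hu) fun x hx =>
            Real.rpow_le_rpow (sub_nonneg.2 hx) (by linarith) hp
    _ ≤ ∫ x in {x | h ≤ u x}, (u x - h) ^ p ∂μ :=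
        setIntegral_mono_set hint
          (ae_restrict_of_forall_mem (measurableSet_le measurable_const hu) fun x hx =>
            Real.rpow_nonneg (sub_nonneg.2 hx) p) hsub.eventuallyLE

theorem sub_rpow_mul_measureReal_superlevel_le [IsFiniteMeasure μ] (hp : 0 ≤ p)
    (hu : Measurable u) (hLp : Integrable (fun x => |u x| ^ p) μ) {h k : ℝ} (hh : 0 ≤ h)
    (hhk : h ≤ k) :
    (k - h) ^ p * μ.real {x | k ≤ u x} ≤ ∫ x in {x | h ≤ u x}, (u x - h) ^ p ∂μ := by
  have hint := integrableOn_sub_rpow hp hu hLp hh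
  have hsub : {x | k ≤ u x} ⊆ {x | h ≤ u x} := fun x hx => hhk.trans hx
  calc (k - h) ^ p * μ.real {x | k ≤ u x} = ∫ _ in {x | k ≤ u x}, (k - h) ^ p ∂μ := by
        rw [setIntegral_const, smul_eq_mul, mul_comm]
    _ ≤ ∫ x in {x | k ≤ u x}, (u x - h) ^ p ∂μ :=
        setIntegral_mono_on (integrable_const _) (hint.mono_set hsub)
          (measurableSet_le measurable_const hu) fun x hx =>
            Real.rpow_le_rpow (sub_nonneg.2 hhk) (sub_le_sub_right hx h) hp
    _ ≤ ∫ x in {x | h ≤ u x}, (u x - h) ^ p ∂μ :=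
        setIntegral_mono_set hint
          (ae_restrict_of_forall_mem (measurableSet_le measurable_const hu) fun x hx =>
            Real.rpow_nonneg (sub_nonneg.2 hx) p) hsub.eventuallyLE

theorem tendsto_setIntegral_sub_rpow_atTop (hp : 0 ≤ p) (hu : Measurable u)
    (hLp : Integrable (fun x => |u x| ^ p) μ) :
    Tendsto (fun k : ℝ => ∫ x in {x | k ≤ u x}, (u x - k) ^ p ∂μ) atTop (𝓝 0) := by
  have hmeas (k : ℝ) : MeasurableSet {x | k ≤ u x} := measurableSet_le measurable_const hu
  simp_rw [← integral_indicator (hmeas _)]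
  have hlim : Tendsto (fun k : ℝ => ∫ x, {x | k ≤ u x}.indicator (fun x => (u x - k) ^ p) x ∂μ)
      atTop (𝓝 (∫ _, 0 ∂μ)) := by
    refine tendsto_integral_filter_of_dominated_convergence (fun x => |u x| ^ p)
      (Eventually.of_forall fun k => ?_) ?_ hLp (Eventually.of_forall fun x => ?_)
    · exact (Measurable.indicator (by fun_prop) (hmeas k)).aestronglyMeasurable
    · filter_upwards [eventually_ge_atTop (0 : ℝ)] with k hk
      refine Eventually.of_forall fun x => ?_
      by_cases hx : k ≤ u x
      · rw [Set.indicator_of_mem (by exact hx),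
          Real.norm_of_nonneg (Real.rpow_nonneg (sub_nonneg.2 hx) p)]
        exact Real.rpow_le_rpow (sub_nonneg.2 hx) (by linarith [le_abs_self (u x)]) hp
      · rw [Set.indicator_of_notMem (by exact hx), norm_zero]
        positivity
    · refine tendsto_const_nhds.congr' ?_
      filter_upwards [eventually_gt_atTop (u x)] with k hk
      rw [Set.indicator_of_notMem (by simpa using hk)]
  simpa using hlim

theorem ae_le_of_setIntegral_sub_rpow_eq_zero (hp : 0 < p) (hu : Measurable u)
    (hLp : Integrable (fun x => |u x| ^ p) μ) {k : ℝ} (hk : 0 ≤ k)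
    (h0 : ∫ x in {x | k ≤ u x}, (u x - k) ^ p ∂μ = 0) : ∀ᵐ x ∂μ, u x ≤ k := by
  have hmeas : MeasurableSet {x | k ≤ u x} := measurableSet_le measurable_const hu
  rw [setIntegral_eq_zero_iff_of_nonneg_ae
    (ae_restrict_of_forall_mem hmeas fun x hx => Real.rpow_nonneg (sub_nonneg.2 hx) p)
    (integrableOn_sub_rpow hp.le hu hLp hk), EventuallyEq, ae_restrict_iff' hmeas] at h0
  filter_upwards [h0] with x hx
  by_contra! hlt
  exact (Real.rpow_pos_of_pos (sub_pos.2 hlt) p).ne' (hx hlt.le)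

/-- **De Giorgi boundedness lemma** for a finite measure. -/
theorem exists_ae_le_of_superlevel_rpow_le [IsFiniteMeasure μ] (hp : 0 < p) (hu : Measurable u)
    (hLp : Integrable (fun x => |u x| ^ p) μ) {c r K : ℝ} (hr : 1 < r) (hc : 0 < c)
    (hdg : ∀ k : ℝ, K ≤ k →
      (∫ x in {x | k ≤ u x}, (u x - k) ^ p ∂μ) ^ (1 / r) ≤
        c * ((∫ x in {x | k ≤ u x}, (u x - k) ^ p ∂μ) + k ^ p * μ.real {x | k ≤ u x})) :
    ∃ M : ℝ, 0 < M ∧ ∀ᵐ x ∂μ, u x ≤ M := by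
  set F : ℝ → ℝ := fun k => ∫ x in {x | k ≤ u x}, (u x - k) ^ p ∂μ with hF
  have hF0 (k : ℝ) : 0 ≤ F k := setIntegral_sub_rpow_nonneg hu k
  obtain ⟨δ, hδ, hconv⟩ := exists_forall_le_tendsto_zero_of_le_rpow
    (B := 2 ^ p) (C := 2 * c * 4 ^ p) (Real.one_lt_rpow one_lt_two hp) (by positivity) hr
  obtain ⟨m, hmδ, hmK, hm⟩ := (((tendsto_setIntegral_sub_rpow_atTop hp.le hu hLp).eventually
    (Iio_mem_nhds hδ)).and ((eventually_ge_atTop K).and (eventually_gt_atTop 0))).exists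
  set k : ℕ → ℝ := fun n => m * (2 - (1 / 2) ^ n) with hk
  have hpow (n : ℕ) : (1 / 2 : ℝ) ^ n ≤ 1 := pow_le_one₀ (by norm_num) (by norm_num)
  have hmk (n : ℕ) : m ≤ k n := le_mul_of_one_le_right hm.le (by linarith [hpow n])
  have hk2 (n : ℕ) : k n ≤ 2 * m := by
    have : 0 < m * (1 / 2) ^ n := by positivity
    simp only [hk]
    linarith
  have hdiff (n : ℕ) : k (n + 1) - k n = m * (1 / 2) ^ (n + 1) := by
    simp only [hk]
    ring
  have hstep (n : ℕ) : F (k (n + 1)) ≤ (2 * c * 4 ^ p * (2 ^ p) ^ n * F (k n)) ^ r := by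
    have hkn : 0 ≤ k n := hm.le.trans (hmk n)
    have hkn' : 0 ≤ k (n + 1) := hm.le.trans (hmk (n + 1))
    have hle : k n ≤ k (n + 1) := by
      rw [← sub_nonneg, hdiff]
      positivity
    have hanti : F (k (n + 1)) ≤ F (k n) := setIntegral_sub_rpow_antitone hp.le hu hLp hkn hle
    have hratio : k (n + 1) ≤ 4 * 2 ^ n * (k (n + 1) - k n) := by
      refine (hk2 (n + 1)).trans_eq ?_
      have : (2 : ℝ) ^ n * (1 / 2) ^ n = 1 := by
        rw [← mul_pow]
        norm_num
      rw [hdiff, pow_succ]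
      linear_combination (-2 * m) * this
    have hcheb : k (n + 1) ^ p * μ.real {x | k (n + 1) ≤ u x} ≤
        4 ^ p * (2 ^ p) ^ n * F (k n) :=
      calc k (n + 1) ^ p * μ.real {x | k (n + 1) ≤ u x}
          ≤ (4 * 2 ^ n * (k (n + 1) - k n)) ^ p * μ.real {x | k (n + 1) ≤ u x} := by gcongr
        _ = 4 ^ p * (2 ^ p) ^ n * ((k (n + 1) - k n) ^ p * μ.real {x | k (n + 1) ≤ u x}) := by
            rw [Real.mul_rpow (by positivity) (sub_nonneg.2 hle),
              Real.mul_rpow (by positivity) (by positivity), Real.rpow_pow_comm (by norm_num)]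
            ring
        _ ≤ 4 ^ p * (2 ^ p) ^ n * F (k n) := by
            gcongr
            exact sub_rpow_mul_measureReal_superlevel_le hp.le hu hLp hkn hle
    have hone : 1 ≤ (4 : ℝ) ^ p * (2 ^ p) ^ n :=
      one_le_mul_of_one_le_of_one_le (Real.one_le_rpow (by norm_num) hp.le)
        (one_le_pow₀ (Real.one_le_rpow (by norm_num) hp.le))
    have hroot : F (k (n + 1)) ^ (1 / r) ≤ 2 * c * 4 ^ p * (2 ^ p) ^ n * F (k n) :=
      calc F (k (n + 1)) ^ (1 / r)
          ≤ c * (F (k (n + 1)) + k (n + 1) ^ p * μ.real {x | k (n + 1) ≤ u x}) :=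
            hdg _ (hmK.trans (hmk _))
        _ ≤ c * (4 ^ p * (2 ^ p) ^ n * F (k n) + 4 ^ p * (2 ^ p) ^ n * F (k n)) := by
            gcongr
            exact hanti.trans (le_mul_of_one_le_left (hF0 _) hone)
        _ = 2 * c * 4 ^ p * (2 ^ p) ^ n * F (k n) := by ring
    calc F (k (n + 1)) = (F (k (n + 1)) ^ (1 / r)) ^ r := by
          rw [← Real.rpow_mul (hF0 _), one_div_mul_cancel (by positivity), Real.rpow_one]
      _ ≤ _ := Real.rpow_le_rpow (Real.rpow_nonneg (hF0 _) _) hroot (by positivity)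
  have hk0 : k 0 = m := by
    simp only [hk]
    ring
  have htend := hconv (fun n => F (k n)) (fun n => hF0 _) hstep (by
    simp only [hk0]
    exact le_of_lt hmδ)
  have hzero : F (2 * m) = 0 := le_antisymm (ge_of_tendsto' htend fun n =>
    setIntegral_sub_rpow_antitone hp.le hu hLp (hm.le.trans (hmk n)) (hk2 n)) (hF0 _)
  exact ⟨2 * m, by positivity,
    ae_le_of_setIntegral_sub_rpow_eq_zero hp hu hLp (by positivity) hzero⟩

end Superlevel

/-- **De Giorgi-type boundedness lemma.** Let `Ω ⊆ ℝ^N` be a bounded measurable set,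
`p, r > 1`, and `u ∈ L^p(Ω)`. If for all `k ≥ K` the quantity
`(∫_{Ω_k} (u-k)^p)^{1/r}` is bounded by `c [∫_{Ω_k} (u-k)^p + k^p |Ω_k|]`, where
`Ω_k = {x ∈ Ω : u x ≥ k}`, then `u` is bounded above by some `M > 0` a.e. in `Ω`. -/
theorem stmt_2 {N : ℕ} (Ω : Set (Fin N → ℝ)) (hΩmeas : MeasurableSet Ω)
    (hΩbdd : Bornology.IsBounded Ω)
    (p r : ℝ) (hp : 1 < p) (hr : 1 < r)
    (u : (Fin N → ℝ) → ℝ) (hu : Measurable u)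
    (hLp : IntegrableOn (fun x => |u x| ^ p) Ω volume)
    (c K : ℝ) (hc : 0 < c) (hK : 0 < K)
    (hdg : ∀ k : ℝ, K ≤ k →
      (∫ x in {x ∈ Ω | k ≤ u x}, (u x - k) ^ p) ^ (1 / r) ≤
        c * ((∫ x in {x ∈ Ω | k ≤ u x}, (u x - k) ^ p) +
          k ^ p * (volume {x ∈ Ω | k ≤ u x}).toReal)) :
    ∃ M : ℝ, 0 < M ∧ ∀ᵐ x ∂(volume.restrict Ω), u x ≤ M := by
  have : IsFiniteMeasure (volume.restrict Ω) := ⟨by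
    simpa using hΩbdd.measure_lt_top⟩
  have hmeas (k : ℝ) : MeasurableSet {x | k ≤ u x} := measurableSet_le measurable_const hu
  have hset (k : ℝ) : {x ∈ Ω | k ≤ u x} = {x | k ≤ u x} ∩ Ω := by
    ext x
    exact and_comm
  refine exists_ae_le_of_superlevel_rpow_le (c := c) (K := K) (by linarith) hu hLp hr hc
    fun k hk => ?_
  have hdgk := hdg k hk
  rw [hset, ← Measure.restrict_restrict (hmeas k), ← Measure.restrict_apply (hmeas k)] at hdgk
  exact hdgk
end

section
/- The function Ψ is a Young function of class C² on (0,∞): Ψ is continuous on [0,∞), strictly increasing and convex, with Ψ′(t) > 0 and Ψ″(t) > 0 for all t > 0, and it satisfies lim_{t→0⁺} Ψ(t)/t = 0 and lim_{t→+∞} Ψ(t)/t = +∞. -/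
open Filter Topology Real

/-- Gluing two differentiable functions along a point where values and derivatives agree. -/
theorem hasDerivAt_glue {f f₁ f₂ d₁ d₂ : ℝ → ℝ} {c : ℝ} (hc : 0 < c)
    (h₁ : ∀ t, 0 < t → t ≤ c → f t = f₁ t) (h₂ : ∀ t, c ≤ t → f t = f₂ t)
    (hd₁ : ∀ t, 0 < t → t ≤ c → HasDerivAt f₁ (d₁ t) t)
    (hd₂ : ∀ t, c ≤ t → HasDerivAt f₂ (d₂ t) t) (hd : d₁ c = d₂ c) {t : ℝ} (ht : 0 < t) :
    HasDerivAt f (if t ≤ c then d₁ t else d₂ t) t := by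
  rcases lt_trichotomy t c with h | rfl | h
  · rw [if_pos h.le]
    refine (hd₁ t ht h.le).congr_of_eventuallyEq ?_
    filter_upwards [Ioo_mem_nhds ht h] with s hs using h₁ s hs.1 hs.2.le
  · rw [if_pos le_rfl]
    have hl : HasDerivWithinAt f (d₁ t) (Set.Ioc 0 t) t :=
      (hd₁ t ht le_rfl).hasDerivWithinAt.congr (fun s hs => h₁ s hs.1 hs.2) (h₁ t ht le_rfl)
    have hr : HasDerivWithinAt f (d₁ t) (Set.Ici t) t := by
      rw [hd]
      exact (hd₂ t le_rfl).hasDerivWithinAt.congr h₂ (h₂ t le_rfl)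
    refine (hl.union hr).hasDerivAt ?_
    rw [Set.Ioc_union_Ici_eq_Ioi ht]
    exact Ioi_mem_nhds ht
  · rw [if_neg h.not_ge]
    refine (hd₂ t h.le).congr_of_eventuallyEq ?_
    filter_upwards [Ioi_mem_nhds h] with s hs using h₂ s (le_of_lt hs)

/-- Gluing two continuous functions along a point where their values agree. -/
theorem continuousAt_glue {f₁ f₂ : ℝ → ℝ} {c t : ℝ}
    (h₁ : t ≤ c → ContinuousAt f₁ t) (h₂ : c ≤ t → ContinuousAt f₂ t) (h : f₁ c = f₂ c) :
    ContinuousAt (fun s => if s ≤ c then f₁ s else f₂ s) t := by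
  rcases lt_trichotomy t c with ht | rfl | ht
  · refine (h₁ ht.le).congr ?_
    filter_upwards [Iio_mem_nhds ht] with s hs using (if_pos (le_of_lt hs)).symm
  · refine continuousAt_iff_continuous_left_right.2 ⟨?_, ?_⟩
    · exact (h₁ le_rfl).continuousWithinAt.congr (fun s hs => if_pos hs) (if_pos le_rfl)
    · have key : ∀ s ∈ Set.Ici t, (if s ≤ t then f₁ s else f₂ s) = f₂ s := by
        intro s hs
        split_ifs with hst
        · rw [le_antisymm hst hs, h]
        · rfl
      exact (h₂ le_rfl).continuousWithinAt.congr key (key t Set.self_mem_Ici)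
  · refine (h₂ ht.le).congr ?_
    filter_upwards [Ioi_mem_nhds ht] with s hs using (if_neg (not_le_of_gt hs)).symm

theorem one_le_log_of_exp_one_le {t : ℝ} (ht : exp 1 ≤ t) : 1 ≤ log t :=
  (le_log_iff_exp_le ((exp_pos 1).trans_le ht)).2 ht

/-- The first derivative of the exponent `η`. -/
noncomputable def etaDeriv (β ε t : ℝ) : ℝ :=
  if t ≤ exp 1 then -(β * ε / exp 1 ^ 2) * (exp 1 - t) else β * sin (ε * log (log t)) / t

/-- The second derivative of the exponent `η`. -/
noncomputable def etaDerivTwo (β ε t : ℝ) : ℝ :=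
  if t ≤ exp 1 then β * ε / exp 1 ^ 2
  else β * (ε * cos (ε * log (log t)) / log t - sin (ε * log (log t))) / t ^ 2

theorem hasDerivAt_const_mul_log_log (ε : ℝ) {t : ℝ} (ht : exp 1 ≤ t) :
    HasDerivAt (fun s => ε * log (log s)) (ε * (t⁻¹ / log t)) t := by
  have h0 : 0 < t := (exp_pos 1).trans_le ht
  have h1 := one_le_log_of_exp_one_le ht
  exact ((hasDerivAt_log h0.ne').log (by positivity)).const_mul ε

theorem hasDerivAt_eta {β ε : ℝ} {η : ℝ → ℝ}
    (hη1 : ∀ t : ℝ, 0 ≤ t → t ≤ exp 1 →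
      η t = β * ε / (2 * exp 1 ^ 2) * (exp 1 - t) ^ 2 - β * ε / (1 + ε ^ 2))
    (hη2 : ∀ t : ℝ, exp 1 ≤ t →
      η t = β * log t / (1 + ε ^ 2) * (sin (ε * log (log t)) - ε * cos (ε * log (log t))))
    {t : ℝ} (ht : 0 < t) : HasDerivAt η (etaDeriv β ε t) t := by
  have he := exp_pos 1
  refine hasDerivAt_glue (d₁ := fun t => -(β * ε / exp 1 ^ 2) * (exp 1 - t))
    (d₂ := fun t => β * sin (ε * log (log t)) / t) he (fun t h0 h => hη1 t h0.le h) hη2 ?_ ?_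
    (by simp) ht
  · intro t _ _
    have h := ((((hasDerivAt_id t).const_sub (exp 1)).pow 2).const_mul
      (β * ε / (2 * exp 1 ^ 2))).sub_const (β * ε / (1 + ε ^ 2))
    refine h.congr_deriv ?_
    simp only [id]
    field_simp
    norm_num
  · intro t ht
    have h0 : 0 < t := he.trans_le ht
    have hl := one_le_log_of_exp_one_le ht
    have hl0 : 0 < log t := by linarith
    have hu := hasDerivAt_const_mul_log_log ε ht
    have h := (((hasDerivAt_log h0.ne').const_mul β).div_const (1 + ε ^ 2)).mul
      (hu.sin.sub (hu.cos.const_mul ε))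
    refine h.congr_deriv ?_
    have : (1 + ε ^ 2) ≠ 0 := by positivity
    simp only [Pi.sub_apply]
    field_simp
    ring

theorem hasDerivAt_etaDeriv (β ε : ℝ) {t : ℝ} (ht : 0 < t) :
    HasDerivAt (etaDeriv β ε) (etaDerivTwo β ε t) t := by
  have he := exp_pos 1
  refine hasDerivAt_glue (f₁ := fun t => -(β * ε / exp 1 ^ 2) * (exp 1 - t))
    (f₂ := fun t => β * sin (ε * log (log t)) / t)
    (d₁ := fun _ => β * ε / exp 1 ^ 2)
    (d₂ := fun t => β * (ε * cos (ε * log (log t)) / log t - sin (ε * log (log t))) / t ^ 2)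
    he (fun t _ h => if_pos h) ?_ ?_ ?_ (by simp) ht
  · intro t ht
    split_ifs with h
    · simp [le_antisymm h ht]
    · rfl
  · intro t _ _
    refine (((hasDerivAt_id t).const_sub (exp 1)).const_mul (-(β * ε / exp 1 ^ 2))).congr_deriv ?_
    ring
  · intro t ht
    have h0 : 0 < t := he.trans_le ht
    have hl := one_le_log_of_exp_one_le ht
    have hl0 : 0 < log t := by linarith
    have hu := hasDerivAt_const_mul_log_log ε ht
    refine ((hu.sin.const_mul β).div (hasDerivAt_id t) h0.ne').congr_deriv ?_
    simp only [id]
    field_simp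

theorem continuousAt_etaDerivTwo (β ε : ℝ) (t : ℝ) : ContinuousAt (etaDerivTwo β ε) t := by
  refine continuousAt_glue (f₁ := fun _ => β * ε / exp 1 ^ 2)
    (f₂ := fun t => β * (ε * cos (ε * log (log t)) / log t - sin (ε * log (log t))) / t ^ 2)
    (fun _ => continuousAt_const) (fun ht => ?_) (by simp)
  have h0 : 0 < t := (exp_pos 1).trans_le ht
  have hl := one_le_log_of_exp_one_le ht
  have hl0 : log t ≠ 0 := by linarith
  have hL : ContinuousAt log t := continuousAt_log h0.ne'
  have hu : ContinuousAt (fun s => ε * log (log s)) t :=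
    (hasDerivAt_const_mul_log_log ε ht).continuousAt
  have hs : ContinuousAt (fun s => sin (ε * log (log s))) t :=
    continuous_sin.continuousAt.comp hu
  have hcos : ContinuousAt (fun s => cos (ε * log (log s))) t :=
    continuous_cos.continuousAt.comp hu
  exact (continuousAt_const.mul (((continuousAt_const.mul hcos).div hL hl0).sub hs)).div
    (continuousAt_id.pow 2) (by simp [h0.ne'])

theorem neg_le_mul_etaDeriv {β ε t : ℝ} (hβ : 0 < β) (hε0 : 0 < ε) (hε4 : ε < 4) (ht : 0 < t) :
    -β ≤ t * etaDeriv β ε t := by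
  have he := exp_pos 1
  unfold etaDeriv
  split_ifs with h
  · have key : t * (-(β * ε / exp 1 ^ 2) * (exp 1 - t))
        = -(β * (ε * (t / exp 1 * (1 - t / exp 1)))) := by
      field_simp
    have hs : t / exp 1 * (1 - t / exp 1) ≤ 1 / 4 := by nlinarith [sq_nonneg (t / exp 1 - 1 / 2)]
    have : ε * (t / exp 1 * (1 - t / exp 1)) ≤ 1 := by nlinarith
    rw [key]
    nlinarith
  · rw [mul_div_cancel₀ _ ht.ne']
    nlinarith [neg_one_le_sin (ε * log (log t))]

theorem neg_mul_le_mul_etaDeriv_add_etaDerivTwo {β ε t : ℝ} (hβ : 0 < β) (hε0 : 0 < ε) (ht : 0 < t) :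
    -(ε * β) ≤ t * etaDeriv β ε t + t ^ 2 * etaDerivTwo β ε t := by
  have he := exp_pos 1
  have hb : 0 < ε * β := by positivity
  unfold etaDeriv etaDerivTwo
  split_ifs with h
  · have key : t * (-(β * ε / exp 1 ^ 2) * (exp 1 - t)) + t ^ 2 * (β * ε / exp 1 ^ 2)
        = -(ε * β * (t / exp 1 * (1 - 2 * (t / exp 1)))) := by
      field_simp
      ring
    have hs : t / exp 1 * (1 - 2 * (t / exp 1)) ≤ 1 := by
      nlinarith [sq_nonneg (t / exp 1 - 1 / 4)]
    rw [key]
    nlinarith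
  · push Not at h
    have hl := one_le_log_of_exp_one_le h.le
    have hl0 : 0 < log t := by linarith
    have key : t * (β * sin (ε * log (log t)) / t)
        + t ^ 2 * (β * (ε * cos (ε * log (log t)) / log t - sin (ε * log (log t))) / t ^ 2)
        = ε * β * (cos (ε * log (log t)) / log t) := by
      field_simp
      ring
    have hc : -1 ≤ cos (ε * log (log t)) / log t := by
      rw [le_div_iff₀ hl0]
      linarith [neg_one_le_cos (ε * log (log t))]
    rw [key]
    nlinarith

theorem neg_mul_log_le_eta {β ε t : ℝ} (hβ : 0 < β) (ht : exp 1 ≤ t) :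
    -(β * log t) ≤
      β * log t / (1 + ε ^ 2) * (sin (ε * log (log t)) - ε * cos (ε * log (log t))) := by
  have hl := one_le_log_of_exp_one_le ht
  have hb : 0 < β * log t := by positivity
  generalize ε * log (log t) = u
  have hsc : -(1 + ε ^ 2) ≤ sin u - ε * cos u := by
    nlinarith [sin_sq_add_cos_sq u, sq_nonneg (sin u + 1), sq_nonneg (ε - cos u),
      neg_one_le_sin u, sq_nonneg (2 * sin u + 1), sq_nonneg (2 * ε - cos u)]
  rw [div_mul_eq_mul_div, le_div_iff₀ (by positivity)]
  nlinarith

/-- The pathological function `Ψ(t) = t^α e^{η(t)}` of Lemma A.1 is a Young function of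
class `C²` on `(0,∞)`: continuous on `[0,∞)`, strictly increasing and convex, with
`Ψ' > 0` and `Ψ'' > 0` on `(0,∞)`, `Ψ(t)/t → 0` as `t → 0⁺` and `Ψ(t)/t → +∞` as
`t → +∞`. -/
theorem stmt_3 (p q ε : ℝ) (hq : 1 < q) (hpq : q < p)
    (hε0 : 0 < ε) (hε : ε < min 4 ((q - 1) / ((p - q) / 2)))
    (η Ψ : ℝ → ℝ)
    (hη1 : ∀ t : ℝ, 0 ≤ t → t ≤ Real.exp 1 →
      η t = (p - q) / 2 * ε / (2 * Real.exp 1 ^ 2) * (Real.exp 1 - t) ^ 2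
            - (p - q) / 2 * ε / (1 + ε ^ 2))
    (hη2 : ∀ t : ℝ, Real.exp 1 ≤ t →
      η t = (p - q) / 2 * Real.log t / (1 + ε ^ 2) *
        (Real.sin (ε * Real.log (Real.log t)) - ε * Real.cos (ε * Real.log (Real.log t))))
    (hΨ : ∀ t : ℝ, 0 ≤ t → Ψ t = t ^ ((p + q) / 2) * Real.exp (η t)) :
    ContinuousOn Ψ (Set.Ici 0) ∧
    StrictMonoOn Ψ (Set.Ici 0) ∧
    ConvexOn ℝ (Set.Ici 0) Ψ ∧
    ContDiffOn ℝ 2 Ψ (Set.Ioi 0) ∧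
    (∀ t : ℝ, 0 < t → 0 < deriv Ψ t) ∧
    (∀ t : ℝ, 0 < t → 0 < deriv (deriv Ψ) t) ∧
    Tendsto (fun t => Ψ t / t) (nhdsWithin 0 (Set.Ioi 0)) (𝓝 0) ∧
    Tendsto (fun t => Ψ t / t) atTop atTop := by
  set α := (p + q) / 2 with hα
  set β := (p - q) / 2 with hβdef
  have hβ : 0 < β := by rw [hβdef]; linarith
  have hαβ : α - β = q := by rw [hα, hβdef]; ring
  have hε4 : ε < 4 := hε.trans_le (min_le_left _ _)
  have hεβ : ε * β < q - 1 := (lt_div_iff₀ hβ).1 (hε.trans_le (min_le_right _ _))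
  have hα1 : 1 < α := by linarith
  have hηd : ∀ t, 0 < t → HasDerivAt η (etaDeriv β ε t) t :=
    fun t ht => hasDerivAt_eta hη1 hη2 ht
  have hpos : ∀ t, 0 < t → 0 < Ψ t := fun t ht => by
    rw [hΨ t ht.le]; positivity
  have hΨd : ∀ t, 0 < t → HasDerivAt Ψ (Ψ t * (α / t + etaDeriv β ε t)) t := by
    intro t ht
    have h := (hasDerivAt_rpow_const (p := α) (Or.inl ht.ne')).mul (hηd t ht).exp
    have h' : HasDerivAt Ψ _ t := h.congr_of_eventuallyEq (by
      filter_upwards [Ioi_mem_nhds ht] with s hs using hΨ s (le_of_lt hs))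
    refine h'.congr_deriv ?_
    rw [hΨ t ht.le, rpow_sub_one ht.ne']
    ring
  have hΨd2 : ∀ t, 0 < t → HasDerivAt (deriv Ψ)
      (Ψ t * ((α / t + etaDeriv β ε t) ^ 2 + (-α / t ^ 2 + etaDerivTwo β ε t))) t := by
    intro t ht
    have hg : HasDerivAt (fun s => α / s + etaDeriv β ε s) (-α / t ^ 2 + etaDerivTwo β ε t) t := by
      refine (((hasDerivAt_inv ht.ne').const_mul α).add
        (hasDerivAt_etaDeriv β ε ht)).congr_deriv ?_
      ring
    have h' := ((hΨd t ht).mul hg).congr_of_eventuallyEq (f₁ := deriv Ψ) (by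
      filter_upwards [Ioi_mem_nhds ht] with s hs using (hΨd s hs).deriv)
    refine h'.congr_deriv ?_
    ring
  have hgpos : ∀ t, 0 < t → q ≤ α + t * etaDeriv β ε t := fun t ht => by
    linarith [neg_le_mul_etaDeriv hβ hε0 hε4 ht]
  have hd1 : ∀ t, 0 < t → 0 < deriv Ψ t := by
    intro t ht
    rw [(hΨd t ht).deriv]
    have : α / t + etaDeriv β ε t = (α + t * etaDeriv β ε t) / t := by field_simp
    rw [this]
    exact mul_pos (hpos t ht) (div_pos (by linarith [hgpos t ht]) ht)
  have hd2 : ∀ t, 0 < t → 0 < deriv (deriv Ψ) t := by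
    intro t ht
    rw [(hΨd2 t ht).deriv]
    have : (α / t + etaDeriv β ε t) ^ 2 + (-α / t ^ 2 + etaDerivTwo β ε t)
        = ((α + t * etaDeriv β ε t) ^ 2 - (α + t * etaDeriv β ε t)
          + (t * etaDeriv β ε t + t ^ 2 * etaDerivTwo β ε t)) / t ^ 2 := by
      field_simp
      ring
    rw [this]
    refine mul_pos (hpos t ht) (div_pos ?_ (by positivity))
    nlinarith [hgpos t ht, neg_mul_le_mul_etaDeriv_add_etaDerivTwo hβ hε0 ht]
  have hη0 : ContinuousWithinAt η (Set.Ici 0) 0 := by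
    have hc : Continuous fun t : ℝ =>
        β * ε / (2 * exp 1 ^ 2) * (exp 1 - t) ^ 2 - β * ε / (1 + ε ^ 2) := by fun_prop
    refine hc.continuousWithinAt.congr_of_eventuallyEq ?_ (hη1 0 le_rfl (exp_pos 1).le)
    filter_upwards [self_mem_nhdsWithin, mem_nhdsWithin_of_mem_nhds (Iio_mem_nhds (exp_pos 1))]
      with s hs hs' using hη1 s hs (le_of_lt hs')
  have hcont : ContinuousOn Ψ (Set.Ici 0) := by
    intro t ht
    rcases (Set.mem_Ici.1 ht).eq_or_lt with rfl | h
    · exact ((continuousAt_rpow_const 0 α (Or.inr (by linarith))).continuousWithinAt.mul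
        hη0.rexp).congr (fun s hs => hΨ s hs) (hΨ 0 le_rfl)
    · exact (hΨd t h).continuousAt.continuousWithinAt
  have hdiff : DifferentiableOn ℝ Ψ (Set.Ioi 0) := fun t ht =>
    (hΨd t ht).differentiableAt.differentiableWithinAt
  refine ⟨hcont, ?_, ?_, ?_, hd1, hd2, ?_, ?_⟩
  · exact strictMonoOn_of_deriv_pos (convex_Ici 0) hcont (by simpa using hd1)
  · exact (strictConvexOn_of_deriv2_pos (convex_Ici 0) hcont (by simpa using hd2)).convexOn
  · have hd2c : ContinuousOn (deriv (deriv Ψ)) (Set.Ioi 0) := by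
      have : ContinuousOn (fun t => Ψ t *
          ((α / t + etaDeriv β ε t) ^ 2 + (-α / t ^ 2 + etaDerivTwo β ε t))) (Set.Ioi 0) := by
        intro t ht
        have ht0 : t ≠ 0 := ne_of_gt ht
        exact ((hΨd t ht).continuousAt.mul
          ((((continuousAt_const.div continuousAt_id ht0).add
            (hasDerivAt_etaDeriv β ε ht).continuousAt).pow 2).add
          ((continuousAt_const.div (continuousAt_id.pow 2) (pow_ne_zero 2 ht0)).add
            (continuousAt_etaDerivTwo β ε t)))).continuousWithinAt
      exact this.congr fun t ht => (hΨd2 t ht).deriv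
    have h1 : ContDiffOn ℝ 1 (deriv Ψ) (Set.Ioi 0) := by
      rw [show (1 : WithTop ℕ∞) = 0 + 1 by norm_num,
        contDiffOn_succ_iff_deriv_of_isOpen isOpen_Ioi]
      exact ⟨fun t ht => (hΨd2 t ht).differentiableAt.differentiableWithinAt, by simp,
        contDiffOn_zero.2 hd2c⟩
    rw [show (2 : WithTop ℕ∞) = 1 + 1 by norm_num,
      contDiffOn_succ_iff_deriv_of_isOpen isOpen_Ioi]
    exact ⟨hdiff, by simp, h1⟩
  · have h1 : Tendsto (fun t : ℝ => t ^ (α - 1) * exp (η t)) (𝓝[>] 0) (𝓝 (0 * exp (η 0))) := by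
      refine Tendsto.mul ?_ ((hη0.mono Set.Ioi_subset_Ici_self).rexp)
      have h := (continuousAt_rpow_const 0 (α - 1) (Or.inr (by linarith))).tendsto
      rw [zero_rpow (by linarith)] at h
      exact h.mono_left nhdsWithin_le_nhds
    rw [zero_mul] at h1
    refine h1.congr' ?_
    filter_upwards [self_mem_nhdsWithin] with t ht
    rw [hΨ t (le_of_lt ht), rpow_sub_one (ne_of_gt ht)]
    ring
  · refine tendsto_atTop_mono' atTop ?_ (tendsto_rpow_atTop (show 0 < q - 1 by linarith))
    filter_upwards [eventually_ge_atTop (exp 1)] with t ht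
    have h0 : 0 < t := (exp_pos 1).trans_le ht
    rw [rpow_sub_one h0.ne']
    refine div_le_div_of_nonneg_right ?_ h0.le
    rw [hΨ t h0.le, rpow_def_of_pos h0, rpow_def_of_pos h0, ← exp_add, exp_le_exp, hη2 t ht,
      ← hαβ]
    linarith [neg_mul_log_le_eta (ε := ε) hβ ht]
end

section
/- The function Ψ satisfies inf_{t>0} tΨ′(t)/Ψ(t) = liminf_{t→+∞} tΨ′(t)/Ψ(t) = q < p = limsup_{t→+∞} tΨ′(t)/Ψ(t) = sup_{t>0} tΨ′(t)/Ψ(t). -/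
open Filter Topology Real

section Extremal

variable {f : ℝ → ℝ} {a b : ℝ}

theorem sInf_image_Ioi_eq_of_frequently (ha : ∀ t, 0 < t → a ≤ f t)
    (hfa : ∃ᶠ t in atTop, f t = a) : sInf (f '' Set.Ioi 0) = a := by
  obtain ⟨t, hta, ht⟩ := (hfa.and_eventually (eventually_gt_atTop 0)).exists
  refine IsLeast.csInf_eq ⟨⟨t, ht, hta⟩, ?_⟩
  rintro _ ⟨s, hs, rfl⟩
  exact ha s hs

theorem sSup_image_Ioi_eq_of_frequently (hb : ∀ t, 0 < t → f t ≤ b)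
    (hfb : ∃ᶠ t in atTop, f t = b) : sSup (f '' Set.Ioi 0) = b := by
  obtain ⟨t, htb, ht⟩ := (hfb.and_eventually (eventually_gt_atTop 0)).exists
  refine IsGreatest.csSup_eq ⟨⟨t, ht, htb⟩, ?_⟩
  rintro _ ⟨s, hs, rfl⟩
  exact hb s hs

theorem liminf_atTop_eq_of_frequently (ha : ∀ t, 0 < t → a ≤ f t)
    (hfa : ∃ᶠ t in atTop, f t = a) : liminf f atTop = a := by
  have hev : ∀ᶠ t in atTop, a ≤ f t := (eventually_gt_atTop 0).mono ha
  have hfr : ∃ᶠ t in atTop, f t ≤ a := hfa.mono fun _ h => h.le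
  exact le_antisymm (liminf_le_of_frequently_le hfr (isBoundedUnder_of_eventually_ge hev))
    (le_liminf_of_le (IsCoboundedUnder.of_frequently_le hfr) hev)

theorem limsup_atTop_eq_of_frequently (hb : ∀ t, 0 < t → f t ≤ b)
    (hfb : ∃ᶠ t in atTop, f t = b) : limsup f atTop = b := by
  have hev : ∀ᶠ t in atTop, f t ≤ b := (eventually_gt_atTop 0).mono hb
  have hfr : ∃ᶠ t in atTop, b ≤ f t := hfb.mono fun _ h => h.ge
  exact le_antisymm (limsup_le_of_le (IsCoboundedUnder.of_frequently_ge hfr) hev)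
    (le_limsup_of_frequently_le hfr (isBoundedUnder_of_eventually_le hev))

end Extremal

theorem frequently_sin_mul_log_log_eq {ε : ℝ} (hε : 0 < ε) (θ : ℝ) :
    ∃ᶠ t in atTop, sin (ε * log (log t)) = sin θ := by
  have hlin : Tendsto (fun n : ℕ => (θ + n * (2 * π)) / ε) atTop atTop :=
    (tendsto_atTop_add_const_left _ _
      (tendsto_natCast_atTop_atTop.atTop_mul_const two_pi_pos)).atTop_div_const hε
  refine (tendsto_exp_atTop.comp (tendsto_exp_atTop.comp hlin)).frequently
    (Eventually.of_forall fun n => ?_).frequently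
  simp only [Function.comp_apply, log_exp]
  rw [mul_div_cancel₀ _ hε.ne', sin_add_nat_mul_two_pi]

theorem hasDerivAt_log_mul_sin_sub_cos_log_log (β ε : ℝ) {t : ℝ} (ht : 1 < t) :
    HasDerivAt (fun t => β * log t / (1 + ε ^ 2) *
      (sin (ε * log (log t)) - ε * cos (ε * log (log t))))
      (β * sin (ε * log (log t)) / t) t := by
  have ht0 : t ≠ 0 := by positivity
  have hlog : log t ≠ 0 := (log_pos ht).ne'
  have hl := hasDerivAt_log ht0
  have hll := (hl.log hlog).const_mul ε
  refine (((hl.const_mul β).div_const (1 + ε ^ 2)).mul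
    (hll.sin.sub (hll.cos.const_mul ε))).congr_deriv ?_
  have : 1 + ε ^ 2 ≠ 0 := by positivity
  simp only [Pi.sub_apply]
  field_simp
  ring

theorem hasDerivAt_mul_sub_sq_sub (c d a t : ℝ) :
    HasDerivAt (fun t => c * (a - t) ^ 2 - d) (-(2 * c * (a - t))) t := by
  refine (((((hasDerivAt_id t).const_sub a).pow 2).const_mul c).sub_const d).congr_deriv ?_
  simp
  ring

theorem HasDerivAt.of_eq_on_Icc_of_eq_on_Ici {η η₁ η₂ g₁ g₂ : ℝ → ℝ} {l e t : ℝ}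
    (h₁ : ∀ t, l ≤ t → t ≤ e → η t = η₁ t) (h₂ : ∀ t, e ≤ t → η t = η₂ t)
    (hd₁ : ∀ t, l < t → t ≤ e → HasDerivAt η₁ (g₁ t) t)
    (hd₂ : ∀ t, e ≤ t → HasDerivAt η₂ (g₂ t) t) (hg : g₁ e = g₂ e) (ht : l < t) :
    HasDerivAt η (if t ≤ e then g₁ t else g₂ t) t := by
  rcases lt_trichotomy t e with h | rfl | h
  · rw [if_pos h.le]
    refine (hd₁ t ht h.le).congr_of_eventuallyEq ?_
    filter_upwards [Ioo_mem_nhds ht h] with s hs using h₁ s hs.1.le hs.2.le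
  · rw [if_pos le_rfl, ← hasDerivWithinAt_univ, ← Set.Iic_union_Ici (a := t)]
    refine HasDerivWithinAt.union ?_ ?_
    · refine (hd₁ t ht le_rfl).hasDerivWithinAt.congr_of_eventuallyEq ?_ (h₁ t ht.le le_rfl)
      filter_upwards [self_mem_nhdsWithin, mem_nhdsWithin_of_mem_nhds (Ioi_mem_nhds ht)]
        with s hs hls using h₁ s (le_of_lt hls) hs
    · rw [hg]
      exact (hd₂ t le_rfl).hasDerivWithinAt.congr (fun s hs => h₂ s hs) (h₂ t le_rfl)
  · rw [if_neg h.not_ge]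
    refine (hd₂ t h.le).congr_of_eventuallyEq ?_
    filter_upwards [Ioi_mem_nhds h] with s hs using h₂ s (le_of_lt hs)

theorem mul_deriv_div_rpow_mul_exp {η Ψ : ℝ → ℝ} {α η' t : ℝ} (ht : 0 < t)
    (hΨ : ∀ t, 0 ≤ t → Ψ t = t ^ α * exp (η t)) (hη : HasDerivAt η η' t) :
    t * deriv Ψ t / Ψ t = α + t * η' := by
  have hd := (hasDerivAt_rpow_const (p := α) (Or.inl ht.ne')).mul hη.exp
  have hΨd : HasDerivAt Ψ _ t := hd.congr_of_eventuallyEq <| by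
    filter_upwards [Ioi_mem_nhds ht] with s hs using hΨ s (le_of_lt hs)
  rw [hΨd.deriv, hΨ t ht.le, rpow_sub_one ht.ne']
  have := rpow_pos_of_pos ht α
  field_simp

/-- For the pathological Young function `Ψ(t) = t^α e^{η(t)}` of Lemma A.1, the
index function `t ↦ t Ψ'(t)/Ψ(t)` satisfies
`inf_{t>0} = liminf_{t→∞} = q < p = limsup_{t→∞} = sup_{t>0}`. -/
theorem stmt_4 (p q ε : ℝ) (hq : 1 < q) (hpq : q < p)
    (hε0 : 0 < ε) (hε : ε < min 4 ((q - 1) / ((p - q) / 2)))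
    (η Ψ : ℝ → ℝ)
    (hη1 : ∀ t : ℝ, 0 ≤ t → t ≤ Real.exp 1 →
      η t = (p - q) / 2 * ε / (2 * Real.exp 1 ^ 2) * (Real.exp 1 - t) ^ 2
            - (p - q) / 2 * ε / (1 + ε ^ 2))
    (hη2 : ∀ t : ℝ, Real.exp 1 ≤ t →
      η t = (p - q) / 2 * Real.log t / (1 + ε ^ 2) *
        (Real.sin (ε * Real.log (Real.log t)) - ε * Real.cos (ε * Real.log (Real.log t))))
    (hΨ : ∀ t : ℝ, 0 ≤ t → Ψ t = t ^ ((p + q) / 2) * Real.exp (η t)) :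
    sInf ((fun t => t * deriv Ψ t / Ψ t) '' Set.Ioi 0) = q ∧
    Filter.liminf (fun t => t * deriv Ψ t / Ψ t) atTop = q ∧
    q < p ∧
    Filter.limsup (fun t => t * deriv Ψ t / Ψ t) atTop = p ∧
    sSup ((fun t => t * deriv Ψ t / Ψ t) '' Set.Ioi 0) = p := by
  have hβ : 0 < (p - q) / 2 := by linarith
  have hε4 : ε < 4 := hε.trans_le (min_le_left _ _)
  have he : 0 < exp 1 := exp_pos 1
  have he1 : 1 < exp 1 := one_lt_exp_iff.2 one_pos
  have hη : ∀ t, 0 < t → HasDerivAt η _ t := fun t =>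
    HasDerivAt.of_eq_on_Icc_of_eq_on_Ici hη1 hη2
      (fun t _ _ => hasDerivAt_mul_sub_sq_sub _ _ _ t)
      (fun t ht => hasDerivAt_log_mul_sin_sub_cos_log_log _ ε (he1.trans_le ht)) (by simp)
  have hF : ∀ t, 0 < t → t * deriv Ψ t / Ψ t = _ := fun t ht =>
    mul_deriv_div_rpow_mul_exp ht hΨ (hη t ht)
  have hlarge : ∀ t, exp 1 < t →
      t * deriv Ψ t / Ψ t = (p + q) / 2 + (p - q) / 2 * sin (ε * log (log t)) := by
    intro t ht
    have ht0 : 0 < t := he.trans ht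
    rw [hF t ht0, if_neg ht.not_ge, mul_div_cancel₀ _ ht0.ne']
  have hsmall : ∀ t, 0 < t → t ≤ exp 1 →
      t * deriv Ψ t / Ψ t =
        (p + q) / 2 - (p - q) / 2 * (ε * (t * (exp 1 - t) / exp 1 ^ 2)) := by
    intro t ht hte
    rw [hF t ht, if_pos hte]
    field_simp
    ring
  have hbounds : ∀ t, 0 < t → q ≤ t * deriv Ψ t / Ψ t ∧ t * deriv Ψ t / Ψ t ≤ p := by
    intro t ht
    rcases le_or_gt t (exp 1) with hte | hte
    · rw [hsmall t ht hte]
      have h0 : 0 ≤ t * (exp 1 - t) / exp 1 ^ 2 :=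
        div_nonneg (mul_nonneg ht.le (sub_nonneg.2 hte)) (by positivity)
      have h4 : t * (exp 1 - t) / exp 1 ^ 2 ≤ 1 / 4 := by
        rw [div_le_iff₀ (by positivity)]
        nlinarith [sq_nonneg (2 * t - exp 1)]
      have h1 : ε * (t * (exp 1 - t) / exp 1 ^ 2) ≤ 1 := by nlinarith
      have := mul_le_mul_of_nonneg_left h1 hβ.le
      have := mul_nonneg hβ.le (mul_nonneg hε0.le h0)
      constructor <;> linarith
    · rw [hlarge t hte]
      have := mul_le_mul_of_nonneg_left (neg_one_le_sin (ε * log (log t))) hβ.le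
      have := mul_le_mul_of_nonneg_left (sin_le_one (ε * log (log t))) hβ.le
      constructor <;> linarith
  have hattain : ∀ θ, ∃ᶠ t in atTop,
      t * deriv Ψ t / Ψ t = (p + q) / 2 + (p - q) / 2 * sin θ := fun θ =>
    ((frequently_sin_mul_log_log_eq hε0 θ).and_eventually
      (eventually_gt_atTop (exp 1))).mono fun t ht => by rw [hlarge t ht.2, ht.1]
  have hfq : ∃ᶠ t in atTop, t * deriv Ψ t / Ψ t = q :=
    (hattain (-(π / 2))).mono fun t ht => by rw [ht, sin_neg, sin_pi_div_two]; ring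
  have hfp : ∃ᶠ t in atTop, t * deriv Ψ t / Ψ t = p :=
    (hattain (π / 2)).mono fun t ht => by rw [ht, sin_pi_div_two]; ring
  exact ⟨sInf_image_Ioi_eq_of_frequently (fun t ht => (hbounds t ht).1) hfq,
    liminf_atTop_eq_of_frequently (fun t ht => (hbounds t ht).1) hfq, hpq,
    limsup_atTop_eq_of_frequently (fun t ht => (hbounds t ht).2) hfp,
    sSup_image_Ioi_eq_of_frequently (fun t ht => (hbounds t ht).2) hfp⟩
end

section
/- For every r > 1, the function Ψ satisfies: liminf_{t→+∞} Ψ(t)/t^r = 0 or limsup_{t→+∞} Ψ(t)/t^r = +∞. -/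
open Filter Topology Real

/-- A sequence tending to infinity along which `ε * log (log t)` stays equal to `θ` modulo `2π`. -/
noncomputable def phaseSeq (ε θ : ℝ) (k : ℕ) : ℝ :=
  Real.exp (Real.exp ((θ + k * (2 * π)) / ε))

theorem mul_log_log_phaseSeq {ε : ℝ} (hε : ε ≠ 0) (θ : ℝ) (k : ℕ) :
    ε * Real.log (Real.log (phaseSeq ε θ k)) = θ + k * (2 * π) := by
  simp only [phaseSeq, Real.log_exp]
  field_simp

theorem tendsto_phaseSeq {ε : ℝ} (hε : 0 < ε) (θ : ℝ) :
    Tendsto (phaseSeq ε θ) atTop atTop := by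
  refine Real.tendsto_exp_atTop.comp (Real.tendsto_exp_atTop.comp ?_)
  refine Tendsto.atTop_div_const hε (tendsto_atTop_add_const_left _ _ ?_)
  exact tendsto_natCast_atTop_atTop.atTop_mul_const (by positivity)

/-- A nonnegative function that tends to `0` along a sequence going to infinity has `liminf` `0`. -/
theorem liminf_eq_zero_of_tendsto_comp {f : ℝ → ℝ} {u : ℕ → ℝ} (hf : ∀ᶠ t in atTop, 0 ≤ f t)
    (hu : Tendsto u atTop atTop) (hfu : Tendsto (f ∘ u) atTop (𝓝 0)) :
    liminf f atTop = 0 := by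
  rw [liminf_eq]
  refine IsGreatest.csSup_eq ⟨hf, fun a ha => ?_⟩
  exact ge_of_tendsto hfu (hu.eventually ha)

/-- For the pathological Young function `Ψ(t) = t^α e^{η(t)}` of Lemma A.1 and every
`r > 1`, either `liminf_{t→+∞} Ψ(t)/t^r = 0` or `limsup_{t→+∞} Ψ(t)/t^r = +∞`
(the latter expressed as: `Ψ(t)/t^r` exceeds any bound `M` frequently at infinity). -/
theorem stmt_6 (p q ε : ℝ) (hq : 1 < q) (hpq : q < p)
    (hε0 : 0 < ε) (hε : ε < min 4 ((q - 1) / ((p - q) / 2)))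
    (η Ψ : ℝ → ℝ)
    (hη1 : ∀ t : ℝ, 0 ≤ t → t ≤ Real.exp 1 →
      η t = (p - q) / 2 * ε / (2 * Real.exp 1 ^ 2) * (Real.exp 1 - t) ^ 2
            - (p - q) / 2 * ε / (1 + ε ^ 2))
    (hη2 : ∀ t : ℝ, Real.exp 1 ≤ t →
      η t = (p - q) / 2 * Real.log t / (1 + ε ^ 2) *
        (Real.sin (ε * Real.log (Real.log t)) - ε * Real.cos (ε * Real.log (Real.log t))))
    (hΨ : ∀ t : ℝ, 0 ≤ t → Ψ t = t ^ ((p + q) / 2) * Real.exp (η t)) :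
    ∀ r : ℝ, 1 < r →
      Filter.liminf (fun t => Ψ t / t ^ r) atTop = 0 ∨
      ∀ M : ℝ, ∃ᶠ t in atTop, M < Ψ t / t ^ r := by
  intro r _
  have hβ : 0 < (p - q) / 2 / (1 + ε ^ 2) := by
    have : 0 < p - q := sub_pos.mpr hpq
    positivity
  have ratio_eq (θ : ℝ) (hθ : Real.cos θ = 0) :
      ∀ᶠ k in atTop, Ψ (phaseSeq ε θ k) / phaseSeq ε θ k ^ r =
        Real.exp (Real.log (phaseSeq ε θ k) *
          ((p + q) / 2 - r + (p - q) / 2 / (1 + ε ^ 2) * Real.sin θ)) := by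
    filter_upwards [(tendsto_phaseSeq hε0 θ).eventually_ge_atTop (Real.exp 1)] with k hk
    have hpos : 0 < phaseSeq ε θ k := (Real.exp_pos 1).trans_le hk
    rw [hΨ _ hpos.le, hη2 _ hk, mul_log_log_phaseSeq hε0.ne', Real.sin_add_nat_mul_two_pi,
      Real.cos_add_nat_mul_two_pi, hθ, Real.rpow_def_of_pos hpos, Real.rpow_def_of_pos hpos,
      ← Real.exp_add, ← Real.exp_sub]
    congr 1
    ring
  have log_tendsto (θ : ℝ) : Tendsto (fun k => Real.log (phaseSeq ε θ k)) atTop atTop :=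
    Real.tendsto_log_atTop.comp (tendsto_phaseSeq hε0 θ)
  rcases le_or_gt r ((p + q) / 2) with hr | hr
  · right
    intro M
    have hlim : Tendsto (fun k => Ψ (phaseSeq ε (π / 2) k) / phaseSeq ε (π / 2) k ^ r)
        atTop atTop := by
      refine Tendsto.congr' ((ratio_eq _ Real.cos_pi_div_two).mono fun _ h => h.symm) ?_
      refine Real.tendsto_exp_atTop.comp ((log_tendsto _).atTop_mul_const ?_)
      rw [Real.sin_pi_div_two]
      linarith
    exact (tendsto_phaseSeq hε0 (π / 2)).frequently (hlim.eventually_gt_atTop M).frequently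
  · left
    refine liminf_eq_zero_of_tendsto_comp ?_ (tendsto_phaseSeq hε0 (-(π / 2))) ?_
    · filter_upwards [eventually_ge_atTop 0] with t ht
      rw [hΨ t ht]
      positivity
    · refine Tendsto.congr' ((ratio_eq (-(π / 2)) (by simp)).mono fun _ h => h.symm) ?_
      refine Real.tendsto_exp_atBot.comp ((log_tendsto _).atTop_mul_const_of_neg ?_)
      rw [Real.sin_neg, Real.sin_pi_div_two]
      linarith
end

section
/- If moreover p < N for an integer N ≥ 2, then ∫_1^{+∞} Ψ^{-1}(t) / t^{1 + 1/N} dt = +∞, where Ψ^{-1} denotes the inverse of the strictly increasing bijection Ψ : [0,∞) → [0,∞). -/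
open Filter Topology Real MeasureTheory

/-- The reciprocal function has infinite lower Lebesgue integral at infinity. -/
theorem lintegral_Ioi_ofReal_inv_eq_top {a : ℝ} (ha : 0 ≤ a) :
    ∫⁻ t in Set.Ioi a, ENNReal.ofReal t⁻¹ = ⊤ := by
  by_contra h
  refine not_integrableOn_Ioi_inv (a := a) ⟨by fun_prop, ?_⟩
  rw [hasFiniteIntegral_iff_ofReal]
  · exact Ne.lt_top h
  · filter_upwards [ae_restrict_mem measurableSet_Ioi] with t ht
    exact inv_nonneg.2 (ha.trans (le_of_lt ht))

/-- The oscillating factor is dominated by its normalisation. -/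
theorem sin_sub_mul_cos_le (ε x : ℝ) : sin x - ε * cos x ≤ 1 + ε ^ 2 := by
  have h : (sin x - ε * cos x) ^ 2 ≤ 1 + ε ^ 2 := by
    nlinarith [sq_nonneg (ε * sin x + cos x), sin_sq_add_cos_sq x]
  nlinarith [sq_nonneg ε, sq_nonneg (sin x - ε * cos x - 1)]

/-- For the pathological Young function `Ψ(t) = t^α e^{η(t)}` of Lemma A.1, if
moreover `p < N` for an integer `N ≥ 2`, then `∫_1^∞ Ψ⁻¹(t)/t^{1+1/N} dt = +∞`,
where `Ψ⁻¹` is any right inverse of the strictly increasing bijection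
`Ψ : [0,∞) → [0,∞)` (taking nonnegative values). -/
theorem stmt_7 (p q ε : ℝ) (hq : 1 < q) (hpq : q < p)
    (hε0 : 0 < ε) (hε : ε < min 4 ((q - 1) / ((p - q) / 2)))
    (N : ℕ) (hN : 2 ≤ N) (hpN : p < N)
    (η Ψ : ℝ → ℝ)
    (hη1 : ∀ t : ℝ, 0 ≤ t → t ≤ Real.exp 1 →
      η t = (p - q) / 2 * ε / (2 * Real.exp 1 ^ 2) * (Real.exp 1 - t) ^ 2
            - (p - q) / 2 * ε / (1 + ε ^ 2))
    (hη2 : ∀ t : ℝ, Real.exp 1 ≤ t →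
      η t = (p - q) / 2 * Real.log t / (1 + ε ^ 2) *
        (Real.sin (ε * Real.log (Real.log t)) - ε * Real.cos (ε * Real.log (Real.log t))))
    (hΨ : ∀ t : ℝ, 0 ≤ t → Ψ t = t ^ ((p + q) / 2) * Real.exp (η t))
    (Ψinv : ℝ → ℝ) (hinv0 : ∀ t : ℝ, 0 ≤ t → 0 ≤ Ψinv t)
    (hinv : ∀ t : ℝ, 0 ≤ t → Ψ (Ψinv t) = t) :
    ∫⁻ t in Set.Ioi (1 : ℝ), ENNReal.ofReal (Ψinv t / t ^ (1 + 1 / (N : ℝ))) = ⊤ := by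
  have hβ : 0 < (p - q) / 2 := by linarith
  have hp : 0 < p := by linarith
  have hsmall : ∀ t : ℝ, 0 ≤ t → t ≤ exp 1 → Ψ t ≤
      exp 1 ^ ((p + q) / 2) * exp ((p - q) / 2 * ε / (2 * exp 1 ^ 2) * exp 1 ^ 2) := by
    intro t ht hte
    rw [hΨ t ht, hη1 t ht hte]
    have h1 : 0 < (p - q) / 2 * ε / (1 + ε ^ 2) := by positivity
    have h2 : (exp 1 - t) ^ 2 ≤ exp 1 ^ 2 :=
      pow_le_pow_left₀ (by linarith) (by linarith) 2
    have h3 : 0 ≤ (p - q) / 2 * ε / (2 * exp 1 ^ 2) := by positivity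
    have h4 := mul_le_mul_of_nonneg_left h2 h3
    exact mul_le_mul (rpow_le_rpow ht hte (by linarith)) (exp_le_exp.2 (by linarith))
      (exp_pos _).le (by positivity)
  have hlarge : ∀ t : ℝ, exp 1 ≤ t → Ψ t ≤ t ^ p := by
    intro t ht
    have ht0 : 0 < t := (exp_pos 1).trans_le ht
    have hlog : 0 ≤ log t := by
      have := (le_log_iff_exp_le ht0).2 ht
      linarith
    rw [hΨ t ht0.le, hη2 t ht, rpow_def_of_pos ht0, rpow_def_of_pos ht0, ← exp_add, exp_le_exp]
    have h1 := mul_le_mul_of_nonneg_left (sin_sub_mul_cos_le ε (ε * log (log t)))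
      (show 0 ≤ (p - q) / 2 * log t / (1 + ε ^ 2) by positivity)
    have h2 : (p - q) / 2 * log t / (1 + ε ^ 2) * (1 + ε ^ 2) = (p - q) / 2 * log t := by
      field_simp
    linarith
  set M : ℝ := max 1
    (exp 1 ^ ((p + q) / 2) * exp ((p - q) / 2 * ε / (2 * exp 1 ^ 2) * exp 1 ^ 2))
  have hM1 : 1 ≤ M := le_max_left _ _
  have hbound : ∀ s : ℝ, M < s → s⁻¹ ≤ Ψinv s / s ^ (1 + 1 / (N : ℝ)) := by
    intro s hs
    have hs1 : 1 < s := hM1.trans_lt hs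
    have hs0 : 0 < s := one_pos.trans hs1
    have hy0 := hinv0 s hs0.le
    have hye : exp 1 ≤ Ψinv s := by
      by_contra! hlt
      have := hsmall _ hy0 hlt.le
      rw [hinv s hs0.le] at this
      exact absurd (this.trans (le_max_right 1 _)) (not_le.2 hs)
    have hsp : s ≤ Ψinv s ^ p := by
      simpa only [hinv s hs0.le] using hlarge _ hye
    have hroot : s ^ (1 / (N : ℝ)) ≤ Ψinv s := by
      calc s ^ (1 / (N : ℝ)) ≤ s ^ (1 / p) :=
            rpow_le_rpow_of_exponent_le hs1.le (one_div_le_one_div_of_le hp hpN.le)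
        _ ≤ (Ψinv s ^ p) ^ (1 / p) := rpow_le_rpow hs0.le hsp (by positivity)
        _ = Ψinv s := by rw [one_div, rpow_rpow_inv hy0 hp.ne']
    rw [le_div_iff₀ (by positivity), rpow_add hs0, rpow_one, inv_mul_cancel_left₀ hs0.ne']
    exact hroot
  refine top_unique ?_
  rw [← lintegral_Ioi_ofReal_inv_eq_top (zero_le_one.trans hM1)]
  calc ∫⁻ t in Set.Ioi M, ENNReal.ofReal t⁻¹
      ≤ ∫⁻ t in Set.Ioi M, ENNReal.ofReal (Ψinv t / t ^ (1 + 1 / (N : ℝ))) :=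
        setLIntegral_mono' measurableSet_Ioi fun t ht => ENNReal.ofReal_le_ofReal (hbound t ht)
    _ ≤ _ := lintegral_mono_set (Set.Ioi_subset_Ioi hM1)
end

section
/- The function Ψ is not equivalent to any power function at infinity: there exist no r > 1 and constants c₁, c₂, T > 0 such that c₂ t^r ≤ Ψ(t) ≤ c₁ t^r for all t ≥ T. Equivalently, for every r > 1 it is impossible that both limsup_{t→+∞} Ψ(t)/t^r < +∞ and liminf_{t→+∞} Ψ(t)/t^r > 0 hold. -/
open Filter Topology Real

/-- Arbitrarily large `L` have `ε * log L` congruent to a prescribed angle modulo `2π`. -/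
theorem exists_le_mul_log_eq_add_two_pi {ε : ℝ} (hε : 0 < ε) (θ M : ℝ) :
    ∃ L : ℝ, M ≤ L ∧ ∃ n : ℕ, ε * Real.log L = θ + n * (2 * π) := by
  have h : Tendsto (fun n : ℕ => Real.exp ((θ + n * (2 * π)) / ε)) atTop atTop := by
    refine Real.tendsto_exp_atTop.comp (Tendsto.atTop_div_const hε ?_)
    exact tendsto_atTop_add_const_left _ _
      (tendsto_natCast_atTop_atTop.atTop_mul_const Real.two_pi_pos)
  obtain ⟨n, hn⟩ := (h.eventually_ge_atTop M).exists
  refine ⟨_, hn, n, ?_⟩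
  rw [Real.log_exp]
  field_simp

/-- A real number is nonpositive if its products with arbitrarily large reals stay bounded
above. -/
theorem nonpos_of_forall_exists_mul_le {x C : ℝ} (h : ∀ M : ℝ, ∃ L : ℝ, M ≤ L ∧ L * x ≤ C) :
    x ≤ 0 := by
  by_contra! hx
  obtain ⟨L, hL, hLC⟩ := h ((C + 1) / x)
  rw [div_le_iff₀ hx] at hL
  linarith

/-- The pathological Young function `Ψ(t) = t^α e^{η(t)}` of Lemma A.1 is not
equivalent to any power function at infinity: there are no `r > 1` and constants
`c₁, c₂, T > 0` with `c₂ t^r ≤ Ψ(t) ≤ c₁ t^r` for all `t ≥ T`. -/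
theorem stmt_8 (p q ε : ℝ) (hq : 1 < q) (hpq : q < p)
    (hε0 : 0 < ε) (hε : ε < min 4 ((q - 1) / ((p - q) / 2)))
    (η Ψ : ℝ → ℝ)
    (hη1 : ∀ t : ℝ, 0 ≤ t → t ≤ Real.exp 1 →
      η t = (p - q) / 2 * ε / (2 * Real.exp 1 ^ 2) * (Real.exp 1 - t) ^ 2
            - (p - q) / 2 * ε / (1 + ε ^ 2))
    (hη2 : ∀ t : ℝ, Real.exp 1 ≤ t →
      η t = (p - q) / 2 * Real.log t / (1 + ε ^ 2) *
        (Real.sin (ε * Real.log (Real.log t)) - ε * Real.cos (ε * Real.log (Real.log t))))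
    (hΨ : ∀ t : ℝ, 0 ≤ t → Ψ t = t ^ ((p + q) / 2) * Real.exp (η t)) :
    ¬ ∃ r : ℝ, 1 < r ∧ ∃ c₁ c₂ T : ℝ, 0 < c₁ ∧ 0 < c₂ ∧ 0 < T ∧
      ∀ t : ℝ, T ≤ t → c₂ * t ^ r ≤ Ψ t ∧ Ψ t ≤ c₁ * t ^ r := by
  rintro ⟨r, -, c₁, c₂, T, hc₁, hc₂, hT, h⟩
  set K : ℝ := (p - q) / 2 / (1 + ε ^ 2) with hK
  have hKpos : 0 < K := by
    have : 0 < p - q := sub_pos.2 hpq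
    positivity
  have key : ∀ L : ℝ, max 1 (Real.log T) ≤ L →
      Real.log c₂ ≤ L * ((p + q) / 2 - r + K *
        (Real.sin (ε * Real.log L) - ε * Real.cos (ε * Real.log L))) ∧
      L * ((p + q) / 2 - r + K *
        (Real.sin (ε * Real.log L) - ε * Real.cos (ε * Real.log L))) ≤ Real.log c₁ := by
    intro L hL
    obtain ⟨h1, h2⟩ := max_le_iff.1 hL
    obtain ⟨hlow, hup⟩ := h (Real.exp L) ((Real.log_le_iff_le_exp hT).1 h2)
    rw [hΨ _ (Real.exp_pos L).le, hη2 _ (Real.exp_le_exp.2 h1), Real.log_exp,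
      ← Real.exp_mul, ← Real.exp_mul, ← Real.exp_add] at hlow hup
    rw [← Real.exp_log hc₂, ← Real.exp_add, Real.exp_le_exp] at hlow
    rw [← Real.exp_log hc₁, ← Real.exp_add, Real.exp_le_exp] at hup
    have hKL : (p - q) / 2 * L / (1 + ε ^ 2) = K * L := by rw [hK]; ring
    rw [hKL] at hlow hup
    constructor <;> linarith
  have hle : (p + q) / 2 - r + K ≤ 0 := by
    refine nonpos_of_forall_exists_mul_le (C := Real.log c₁) fun M => ?_
    obtain ⟨L, hL, n, hn⟩ :=
      exists_le_mul_log_eq_add_two_pi hε0 (π / 2) (max M (max 1 (Real.log T)))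
    have hb := (key L ((le_max_right _ _).trans hL)).2
    rw [hn, Real.sin_add_nat_mul_two_pi, Real.cos_add_nat_mul_two_pi, Real.sin_pi_div_two,
      Real.cos_pi_div_two] at hb
    exact ⟨L, (le_max_left _ _).trans hL, by linarith⟩
  have hge : -((p + q) / 2 - r - K) ≤ 0 := by
    refine nonpos_of_forall_exists_mul_le (C := -Real.log c₂) fun M => ?_
    obtain ⟨L, hL, n, hn⟩ :=
      exists_le_mul_log_eq_add_two_pi hε0 (-(π / 2)) (max M (max 1 (Real.log T)))
    have hb := (key L ((le_max_right _ _).trans hL)).1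
    rw [hn, Real.sin_add_nat_mul_two_pi, Real.cos_add_nat_mul_two_pi, Real.sin_neg, Real.cos_neg,
      Real.sin_pi_div_two, Real.cos_pi_div_two] at hb
    exact ⟨L, (le_max_left _ _).trans hL, by linarith⟩
  linarith
end

section
/- Let Ψ₁, Ψ₂ : (0,∞) → (0,∞) be differentiable functions and let 0 < s < i be real numbers such that tΨ₁′(t) ≤ s Ψ₁(t) and i Ψ₂(t) ≤ t Ψ₂′(t) for all t > 0. Then for every η > 0, lim_{t→+∞} Ψ₁(t)/Ψ₂(ηt) = 0. -/
open Filter Topology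

/-- If `t f'(t) ≤ p f(t)` for all `t > 0`, then `f(t) t⁻ᵖ` is nonincreasing on `(0,∞)`. -/
theorem antitoneOn_mul_rpow_neg {f f' : ℝ → ℝ} {p : ℝ}
    (hf : ∀ t : ℝ, 0 < t → HasDerivAt f (f' t) t)
    (hle : ∀ t : ℝ, 0 < t → t * f' t ≤ p * f t) :
    AntitoneOn (fun t => f t * t ^ (-p)) (Set.Ioi 0) := by
  have hd : ∀ t : ℝ, 0 < t → HasDerivAt (fun t => f t * t ^ (-p))
      (f' t * t ^ (-p) + f t * (-p * t ^ (-p - 1))) t := fun t ht =>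
    (hf t ht).mul (Real.hasDerivAt_rpow_const (Or.inl ht.ne'))
  refine antitoneOn_of_deriv_nonpos (convex_Ioi 0)
    (fun t ht => (hd t ht).continuousAt.continuousWithinAt) ?_ ?_
  · rw [interior_Ioi]
    exact fun t ht => (hd t ht).differentiableAt.differentiableWithinAt
  · rw [interior_Ioi]
    intro t ht
    have ht : 0 < t := ht
    have hpow : t ^ (-p) = t * t ^ (-p - 1) := by
      rw [Real.rpow_sub_one ht.ne']
      field_simp
    have hnonpos : (t * f' t - p * f t) * t ^ (-p - 1) ≤ 0 :=
      mul_nonpos_of_nonpos_of_nonneg (sub_nonpos.2 (hle t ht)) (Real.rpow_nonneg ht.le _)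
    rw [(hd t ht).deriv, hpow]
    linarith

/-- If `t f'(t) ≤ p f(t)` for all `t > 0`, then `f(t) ≤ f(1) tᵖ` for `t ≥ 1`. -/
theorem le_mul_rpow_of_mul_deriv_le {f f' : ℝ → ℝ} {p t : ℝ}
    (hf : ∀ t : ℝ, 0 < t → HasDerivAt f (f' t) t)
    (hle : ∀ t : ℝ, 0 < t → t * f' t ≤ p * f t) (ht : 1 ≤ t) :
    f t ≤ f 1 * t ^ p := by
  have ht0 : 0 < t := one_pos.trans_le ht
  have h : f t * t ^ (-p) ≤ f 1 * 1 ^ (-p) :=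
    antitoneOn_mul_rpow_neg hf hle (Set.mem_Ioi.2 one_pos) ht0 ht
  rwa [Real.one_rpow, mul_one, Real.rpow_neg ht0.le, ← div_eq_mul_inv,
    div_le_iff₀ (Real.rpow_pos_of_pos ht0 p)] at h

/-- If `Ψ₁, Ψ₂ : (0,∞) → (0,∞)` are differentiable with `t Ψ₁'(t) ≤ s Ψ₁(t)` and
`i Ψ₂(t) ≤ t Ψ₂'(t)` for all `t > 0`, where `0 < s < i`, then
`Ψ₁(t)/Ψ₂(η t) → 0` as `t → +∞` for every `η > 0`; i.e. `Ψ₁ ≪ Ψ₂`. -/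
theorem stmt_10 (Ψ₁ Ψ₂ Ψ₁' Ψ₂' : ℝ → ℝ)
    (hpos₁ : ∀ t : ℝ, 0 < t → 0 < Ψ₁ t) (hpos₂ : ∀ t : ℝ, 0 < t → 0 < Ψ₂ t)
    (hderiv₁ : ∀ t : ℝ, 0 < t → HasDerivAt Ψ₁ (Ψ₁' t) t)
    (hderiv₂ : ∀ t : ℝ, 0 < t → HasDerivAt Ψ₂ (Ψ₂' t) t)
    (s i : ℝ) (hs : 0 < s) (hsi : s < i)
    (hub : ∀ t : ℝ, 0 < t → t * Ψ₁' t ≤ s * Ψ₁ t)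
    (hlb : ∀ t : ℝ, 0 < t → i * Ψ₂ t ≤ t * Ψ₂' t) :
    ∀ η : ℝ, 0 < η →
      Tendsto (fun t => Ψ₁ t / Ψ₂ (η * t)) atTop (𝓝 0) := by
  intro η hη
  have hlim : Tendsto (fun t : ℝ => Ψ₁ 1 / (Ψ₂ 1 * η ^ i) * t ^ (-(i - s))) atTop (𝓝 0) := by
    simpa using (tendsto_rpow_neg_atTop (sub_pos.2 hsi)).const_mul (Ψ₁ 1 / (Ψ₂ 1 * η ^ i))
  refine squeeze_zero' ?_ ?_ hlim
  · filter_upwards [eventually_gt_atTop 0] with t ht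
    exact (div_pos (hpos₁ t ht) (hpos₂ _ (mul_pos hη ht))).le
  · filter_upwards [eventually_ge_atTop 1, eventually_ge_atTop (1 / η)] with t ht htη
    have ht0 : 0 < t := one_pos.trans_le ht
    have hηt : 1 ≤ η * t := (div_le_iff₀' hη).1 htη
    have h₁ : Ψ₁ t ≤ Ψ₁ 1 * t ^ s := le_mul_rpow_of_mul_deriv_le hderiv₁ hub ht
    have h₂ : -Ψ₂ (η * t) ≤ -Ψ₂ 1 * (η * t) ^ i :=
      le_mul_rpow_of_mul_deriv_le (f := fun t => -Ψ₂ t) (f' := fun t => -Ψ₂' t)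
        (fun t ht => (hderiv₂ t ht).neg) (fun t ht => by linarith [hlb t ht]) hηt
    have hΨ₁ := hpos₁ 1 one_pos
    have hΨ₂ := hpos₂ 1 one_pos
    calc Ψ₁ t / Ψ₂ (η * t) ≤ Ψ₁ 1 * t ^ s / (Ψ₂ 1 * (η * t) ^ i) :=
          div_le_div₀ (by positivity) h₁ (by positivity) (by linarith)
      _ = Ψ₁ 1 / (Ψ₂ 1 * η ^ i) * t ^ (-(i - s)) := by
          rw [neg_sub, Real.rpow_sub ht0, Real.mul_rpow hη.le ht0.le]
          field_simp
end

section
/- Let γ ∈ (0,1), let i > 1 and μ be real numbers with 0 < μ < i, and let Υ : (0,∞) → (0,∞) be a differentiable function satisfying i Υ(t) ≤ t Υ′(t) for all t > 0. Define f(t) := Υ(t)/t + t^{−γ} for t > 0. Then there exists R > 0 such that for all t ≥ R: μ ∫_R^t f(s) ds ≤ t f(t), i.e., μ ∫_R^t ( Υ(s)/s + s^{−γ} ) ds ≤ Υ(t) + t^{1−γ}. -/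
/-- If `Υ t ≤ t Υ'(t)` for all `t > 0`, then `t ↦ Υ t / t` is nondecreasing on `(0,∞)`. -/
theorem monotoneOn_div_self_of_le_mul_deriv {Υ Υ' : ℝ → ℝ}
    (hderiv : ∀ t : ℝ, 0 < t → HasDerivAt Υ (Υ' t) t)
    (hle : ∀ t : ℝ, 0 < t → Υ t ≤ t * Υ' t) :
    MonotoneOn (fun t => Υ t / t) (Set.Ioi 0) := by
  have hd : ∀ t : ℝ, 0 < t →
      HasDerivAt (fun t => Υ t / t) ((Υ' t * t - Υ t * 1) / t ^ 2) t := fun t ht =>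
    (hderiv t ht).div (hasDerivAt_id t) ht.ne'
  refine monotoneOn_of_hasDerivWithinAt_nonneg (convex_Ioi 0)
    (fun t ht => (hd t ht).continuousAt.continuousWithinAt)
    (f' := fun t => (Υ' t * t - Υ t * 1) / t ^ 2) (fun t ht => ?_) (fun t ht => ?_)
  · rw [interior_Ioi] at ht
    exact (hd t ht).hasDerivWithinAt
  · rw [interior_Ioi] at ht
    have := hle t ht
    exact div_nonneg (by linarith) (sq_nonneg t)

/-- **Ambrosetti–Rabinowitz condition for the singular reaction
`f(t) = Υ(t)/t + t^{−γ}`.** Let `γ ∈ (0,1)`, `1 < i`, `0 < μ < i`, and let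
`Υ : (0,∞) → (0,∞)` be differentiable with `i Υ(t) ≤ t Υ'(t)` for all `t > 0`.
Then there is `R > 0` such that `μ ∫_R^t (Υ(s)/s + s^{−γ}) ds ≤ Υ(t) + t^{1−γ}`
for all `t ≥ R`. -/
theorem stmt_14 (γ i μ : ℝ) (hγ0 : 0 < γ) (hγ1 : γ < 1)
    (hi : 1 < i) (hμ0 : 0 < μ) (hμi : μ < i)
    (Υ Υ' : ℝ → ℝ)
    (hpos : ∀ t : ℝ, 0 < t → 0 < Υ t)
    (hderiv : ∀ t : ℝ, 0 < t → HasDerivAt Υ (Υ' t) t)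
    (hiΥ : ∀ t : ℝ, 0 < t → i * Υ t ≤ t * Υ' t) :
    ∃ R : ℝ, 0 < R ∧ ∀ t : ℝ, R ≤ t →
      μ * ∫ s in R..t, (Υ s / s + s ^ (-γ)) ≤ Υ t + t ^ (1 - γ) := by
  have hmono := monotoneOn_div_self_of_le_mul_deriv hderiv fun t ht =>
    (le_mul_of_one_le_left (hpos t ht).le hi.le).trans (hiΥ t ht)
  have hΥ1 := hpos 1 one_pos
  obtain ⟨R, hR1, hR⟩ : ∃ R : ℝ, 1 ≤ R ∧ ∀ t : ℝ, R ≤ t →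
      (μ - (1 - γ)) / ((i - μ) * Υ 1) ≤ t ^ γ := by
    obtain ⟨N, hN⟩ := Filter.eventually_atTop.1
      ((tendsto_rpow_atTop hγ0).eventually_ge_atTop ((μ - (1 - γ)) / ((i - μ) * Υ 1)))
    exact ⟨max 1 N, le_max_left _ _, fun t ht => hN t ((le_max_right _ _).trans ht)⟩
  have hR0 : 0 < R := by linarith
  refine ⟨R, hR0, fun t ht => ?_⟩
  have hg : ∀ s : ℝ, 0 < s → HasDerivAt (fun s => Υ s + s ^ (1 - γ))
      (Υ' s + (1 - γ) * s ^ (-γ)) s := fun s hs => by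
    have h := (hderiv s hs).add (Real.hasDerivAt_rpow_const (p := 1 - γ) (Or.inl hs.ne'))
    rwa [show 1 - γ - 1 = -γ by ring] at h
  have hf : ContinuousOn (fun s => μ * (Υ s / s + s ^ (-γ))) (Set.Icc R t) := fun s hs => by
    have hs0 : 0 < s := hR0.trans_le hs.1
    exact (continuousAt_const.mul
      (((hderiv s hs0).continuousAt.div continuousAt_id hs0.ne').add
      (Real.continuousAt_rpow_const s (-γ) (Or.inl hs0.ne')))).continuousWithinAt
  have hle : ∀ s ∈ Set.Ioo R t,
      μ * (Υ s / s + s ^ (-γ)) ≤ Υ' s + (1 - γ) * s ^ (-γ) := fun s hs => by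
    have hs0 : 0 < s := hR0.trans hs.1
    have hΥ' : i * (Υ s / s) ≤ Υ' s := by
      rw [← mul_div_assoc, div_le_iff₀ hs0, mul_comm (Υ' s)]
      exact hiΥ s hs0
    have hlow : Υ 1 ≤ Υ s / s := by
      simpa using hmono (Set.mem_Ioi.2 one_pos) (Set.mem_Ioi.2 hs0) (hR1.trans hs.1.le)
    have hpow : (μ - (1 - γ)) * s ^ (-γ) ≤ (i - μ) * Υ 1 := by
      rw [Real.rpow_neg hs0.le, ← div_eq_mul_inv, div_le_iff₀ (Real.rpow_pos_of_pos hs0 γ),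
        ← div_le_iff₀' (mul_pos (sub_pos.2 hμi) hΥ1)]
      exact hR s hs.1.le
    have := mul_le_mul_of_nonneg_left hlow (sub_pos.2 hμi).le
    linarith
  have key := intervalIntegral.integral_le_sub_of_hasDeriv_right_of_le ht
    (fun s hs => (hg s (hR0.trans_le hs.1)).continuousAt.continuousWithinAt)
    (fun s hs => (hg s (hR0.trans hs.1)).hasDerivWithinAt)
    hf.integrableOn_Icc hle
  rw [intervalIntegral.integral_const_mul] at key
  have := hpos R hR0
  have := Real.rpow_pos_of_pos hR0 (1 - γ)
  linarith
end

section
/- Let p > 1 and define Φ(t) := ∫_0^t s^{p−1} log(1+s) ds for t ≥ 0. Then p ≤ t Φ′(t)/Φ(t) ≤ p + 1 for all t > 0, and moreover inf_{t>0} t Φ′(t)/Φ(t) = p and sup_{t>0} t Φ′(t)/Φ(t) = p + 1. -/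
theorem continuousOn_rpow_mul_log_one_add {p : ℝ} (hp : 1 < p) {t : ℝ} :
    ContinuousOn (fun s : ℝ => s ^ (p - 1) * Real.log (1 + s)) (Set.Icc 0 t) := by
  refine ContinuousOn.mul ?_ (ContinuousOn.log (by fun_prop) ?_)
  · exact (Real.continuous_rpow_const (by linarith)).continuousOn
  · intro s hs
    have := hs.1
    positivity

theorem intervalIntegrable_rpow_mul_log_one_add {p : ℝ} (hp : 1 < p) {t : ℝ} (ht : 0 < t) :
    IntervalIntegrable (fun s : ℝ => s ^ (p - 1) * Real.log (1 + s)) MeasureTheory.volume 0 t :=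
  (continuousOn_rpow_mul_log_one_add hp).intervalIntegrable_of_Icc ht.le

theorem integral_rpow_zero_left {r : ℝ} (hr : -1 < r) (t : ℝ) :
    ∫ s in (0 : ℝ)..t, s ^ r = t ^ (r + 1) / (r + 1) := by
  rw [integral_rpow (Or.inl hr), Real.zero_rpow (by linarith), sub_zero]

theorem integral_rpow_mul_log_le {p : ℝ} (hp : 1 < p) {t : ℝ} (ht : 0 < t) :
    ∫ s in (0 : ℝ)..t, s ^ (p - 1) * Real.log (1 + s) ≤ t ^ p * Real.log (1 + t) / p := by
  have hint : ∫ s in (0 : ℝ)..t, s ^ (p - 1) * Real.log (1 + t) =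
      t ^ p * Real.log (1 + t) / p := by
    rw [intervalIntegral.integral_mul_const, integral_rpow_zero_left (by linarith),
      sub_add_cancel, div_mul_eq_mul_div]
  rw [← hint]
  refine intervalIntegral.integral_mono_on_of_le_Ioo ht.le
    (intervalIntegrable_rpow_mul_log_one_add hp ht)
    ((intervalIntegral.intervalIntegrable_rpow' (by linarith)).mul_const _) fun s hs => ?_
  obtain ⟨hs₀, hst⟩ := hs
  gcongr

theorem integral_rpow_mul_log_le_rpow {p : ℝ} (hp : 1 < p) {t : ℝ} (ht : 0 < t) :
    ∫ s in (0 : ℝ)..t, s ^ (p - 1) * Real.log (1 + s) ≤ t ^ p * t / (p + 1) := by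
  have hint : ∫ s in (0 : ℝ)..t, s ^ p = t ^ p * t / (p + 1) := by
    rw [integral_rpow_zero_left (by linarith), Real.rpow_add_one ht.ne']
  rw [← hint]
  refine intervalIntegral.integral_mono_on_of_le_Ioo ht.le
    (intervalIntegrable_rpow_mul_log_one_add hp ht)
    (intervalIntegral.intervalIntegrable_rpow' (by linarith)) fun s hs => ?_
  obtain ⟨hs₀, -⟩ := hs
  have hlog : Real.log (1 + s) ≤ s := by
    linarith [Real.log_le_sub_one_of_pos (by linarith : 0 < 1 + s)]
  calc s ^ (p - 1) * Real.log (1 + s) ≤ s ^ (p - 1) * s := by gcongr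
    _ = s ^ p := by rw [← Real.rpow_add_one hs₀.ne', sub_add_cancel]

/-- Concavity of `log` bounds `log (1 + s)` below by the chord `s / t * log (1 + t)`. -/
theorem le_integral_rpow_mul_log_of_concave {p : ℝ} (hp : 1 < p) {t : ℝ} (ht : 0 < t) :
    t ^ p * Real.log (1 + t) / (p + 1) ≤
      ∫ s in (0 : ℝ)..t, s ^ (p - 1) * Real.log (1 + s) := by
  have hint : ∫ s in (0 : ℝ)..t, s ^ p * (Real.log (1 + t) / t) =
      t ^ p * Real.log (1 + t) / (p + 1) := by
    rw [intervalIntegral.integral_mul_const, integral_rpow_zero_left (by linarith),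
      Real.rpow_add_one ht.ne']
    field_simp
  rw [← hint]
  refine intervalIntegral.integral_mono_on_of_le_Ioo ht.le
    ((intervalIntegral.intervalIntegrable_rpow' (by linarith)).mul_const _)
    (intervalIntegrable_rpow_mul_log_one_add hp ht) fun s hs => ?_
  obtain ⟨hs₀, hst⟩ := hs
  have hchord : s * (Real.log (1 + t) / t) ≤ Real.log (1 + s) := by
    have h := strictConcaveOn_log_Ioi.concaveOn.2 (Set.mem_Ioi.2 one_pos)
      (Set.mem_Ioi.2 (by linarith : 0 < 1 + t))
      (sub_nonneg.2 ((div_le_one ht).2 hst.le)) (div_pos hs₀ ht).le (sub_add_cancel 1 (s / t))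
    have hpt : (1 - s / t) * 1 + s / t * (1 + t) = 1 + s := by
      field_simp
      ring
    simp only [smul_eq_mul, Real.log_one, mul_zero, zero_add, hpt] at h
    calc s * (Real.log (1 + t) / t) = s / t * Real.log (1 + t) := by ring
      _ ≤ _ := h
  calc s ^ p * (Real.log (1 + t) / t) = s ^ (p - 1) * (s * (Real.log (1 + t) / t)) := by
        rw [← mul_assoc, ← Real.rpow_add_one hs₀.ne', sub_add_cancel]
    _ ≤ _ := by gcongr

/-- A lower bound that is sharp to leading order at infinity, from
`log (1 + t) - log (1 + s) ≤ t / s - 1`. -/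
theorem le_integral_rpow_mul_log_of_log_sub {p : ℝ} (hp : 1 < p) {t : ℝ} (ht : 0 < t) :
    t ^ p * ((Real.log (1 + t) - 1 / (p - 1)) / p) ≤
      ∫ s in (0 : ℝ)..t, s ^ (p - 1) * Real.log (1 + s) := by
  have hp1 : p - 1 ≠ 0 := by linarith
  have hi₁ : IntervalIntegrable (fun s : ℝ => s ^ (p - 1) * (Real.log (1 + t) + 1))
      MeasureTheory.volume 0 t :=
    (intervalIntegral.intervalIntegrable_rpow' (by linarith)).mul_const _
  have hi₂ : IntervalIntegrable (fun s : ℝ => s ^ (p - 2) * t) MeasureTheory.volume 0 t :=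
    (intervalIntegral.intervalIntegrable_rpow' (by linarith)).mul_const _
  have hint : ∫ s in (0 : ℝ)..t, (s ^ (p - 1) * (Real.log (1 + t) + 1) - s ^ (p - 2) * t) =
      t ^ p * ((Real.log (1 + t) - 1 / (p - 1)) / p) := by
    rw [intervalIntegral.integral_sub hi₁ hi₂, intervalIntegral.integral_mul_const,
      intervalIntegral.integral_mul_const, integral_rpow_zero_left (by linarith),
      integral_rpow_zero_left (by linarith), sub_add_cancel, show p - 2 + 1 = p - 1 by ring,
      Real.rpow_sub_one ht.ne']
    field_simp
    ring
  rw [← hint]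
  refine intervalIntegral.integral_mono_on_of_le_Ioo ht.le (hi₁.sub hi₂)
    (intervalIntegrable_rpow_mul_log_one_add hp ht) fun s hs => ?_
  obtain ⟨hs₀, hst⟩ := hs
  have hlog : Real.log (1 + t) + 1 - t / s ≤ Real.log (1 + s) := by
    have h := Real.log_le_sub_one_of_pos (div_pos (by linarith : 0 < 1 + t)
      (by linarith : 0 < 1 + s))
    rw [Real.log_div (by linarith) (by linarith)] at h
    have hfrac : (1 + t) / (1 + s) ≤ t / s := by
      rw [div_le_div_iff₀ (by linarith) hs₀]
      linarith
    linarith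
  calc s ^ (p - 1) * (Real.log (1 + t) + 1) - s ^ (p - 2) * t
      = s ^ (p - 1) * (Real.log (1 + t) + 1 - t / s) := by
        rw [show p - 2 = p - 1 - 1 by ring, Real.rpow_sub_one hs₀.ne' (p - 1)]
        ring
    _ ≤ _ := by gcongr

/-- For `p > 1` and `Φ(t) = ∫_0^t s^{p−1} log(1+s) ds` (so `Φ'(t) = t^{p−1} log(1+t)`),
one has `p ≤ t Φ'(t)/Φ(t) ≤ p + 1` for all `t > 0`; moreover the infimum over `(0,∞)`
of `t Φ'(t)/Φ(t)` equals `p` and the supremum equals `p + 1` (`i_Φ = p`, `s_Φ = p+1`). -/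
theorem stmt_18 (p : ℝ) (hp : 1 < p) (Φ : ℝ → ℝ)
    (hΦ : ∀ t : ℝ, Φ t = ∫ s in (0 : ℝ)..t, s ^ (p - 1) * Real.log (1 + s)) :
    (∀ t : ℝ, 0 < t →
      p ≤ t * (t ^ (p - 1) * Real.log (1 + t)) / Φ t ∧
      t * (t ^ (p - 1) * Real.log (1 + t)) / Φ t ≤ p + 1) ∧
    sInf ((fun t : ℝ => t * (t ^ (p - 1) * Real.log (1 + t)) / Φ t) '' Set.Ioi 0) = p ∧
    sSup ((fun t : ℝ => t * (t ^ (p - 1) * Real.log (1 + t)) / Φ t) '' Set.Ioi 0)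
      = p + 1 := by
  have hval (t : ℝ) (ht : 0 < t) : 0 < Φ t ∧
      t * (t ^ (p - 1) * Real.log (1 + t)) = t ^ p * Real.log (1 + t) := by
    refine ⟨?_, ?_⟩
    · rw [hΦ]
      refine lt_of_lt_of_le ?_ (le_integral_rpow_mul_log_of_concave hp ht)
      have := Real.log_pos (by linarith : 1 < 1 + t)
      positivity
    · rw [← mul_assoc]
      congr 1
      rw [Real.rpow_sub_one ht.ne']
      field_simp
  have hbounds (t : ℝ) (ht : 0 < t) :
      p ≤ t * (t ^ (p - 1) * Real.log (1 + t)) / Φ t ∧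
      t * (t ^ (p - 1) * Real.log (1 + t)) / Φ t ≤ p + 1 := by
    obtain ⟨hpos, heq⟩ := hval t ht
    rw [heq, le_div_iff₀ hpos, div_le_iff₀ hpos, hΦ]
    have h₁ := integral_rpow_mul_log_le hp ht
    have h₂ := le_integral_rpow_mul_log_of_concave hp ht
    rw [le_div_iff₀ (by linarith)] at h₁
    rw [div_le_iff₀ (by linarith)] at h₂
    exact ⟨by linarith, by linarith⟩
  refine ⟨hbounds, ?_, ?_⟩
  · refine IsGLB.csInf_eq ⟨?_, ?_⟩ (Set.nonempty_Ioi.image _)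
    · rintro _ ⟨t, ht, rfl⟩
      exact (hbounds t ht).1
    · intro b hb
      by_contra! hlt
      have hbp : 0 < b - p := by linarith
      have hp1 : 0 < p - 1 := by linarith
      have hb0 : 0 < b := by linarith
      set c := 1 / (p - 1) with hc
      have hc0 : 0 < c := by positivity
      set L := (b * c + 1) / (b - p) with hL
      have hL0 : 0 < L := by positivity
      have ht : 0 < Real.exp L - 1 := by linarith [Real.add_one_lt_exp hL0.ne']
      obtain ⟨hpos, heq⟩ := hval _ ht
      have hbt := hb ⟨_, ht, rfl⟩
      simp only [heq] at hbt
      rw [le_div_iff₀ hpos, hΦ] at hbt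
      have hlow := le_integral_rpow_mul_log_of_log_sub hp ht
      rw [add_sub_cancel, Real.log_exp] at hlow hbt
      have htp : 0 < (Real.exp L - 1) ^ p := Real.rpow_pos_of_pos ht p
      have h₁ := (mul_le_mul_of_nonneg_left hlow hb0.le).trans hbt
      have h₂ : b * ((L - c) / p) ≤ L := by
        refine le_of_mul_le_mul_left ?_ htp
        linarith
      rw [mul_div_assoc', div_le_iff₀ (by linarith)] at h₂
      have h₃ : L * (b - p) = b * c + 1 := div_mul_cancel₀ _ hbp.ne'
      linarith
  · refine IsLUB.csSup_eq ⟨?_, ?_⟩ (Set.nonempty_Ioi.image _)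
    · rintro _ ⟨t, ht, rfl⟩
      exact (hbounds t ht).2
    · intro b hb
      by_contra! hlt
      have ht : 0 < (p + 1 - b) / (2 * (p + 1)) := div_pos (by linarith) (by linarith)
      set t := (p + 1 - b) / (2 * (p + 1)) with htdef
      obtain ⟨hpos, heq⟩ := hval t ht
      have hbt := hb ⟨t, ht, rfl⟩
      simp only [heq] at hbt
      have hp1 : (0 : ℝ) < p + 1 := by linarith
      have hup : Φ t ≤ t ^ p * t / (p + 1) := hΦ t ▸ integral_rpow_mul_log_le_rpow hp ht
      have hlog : t / (1 + t) ≤ Real.log (1 + t) := by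
        have := Real.one_sub_inv_le_log_of_pos (by linarith : 0 < 1 + t)
        convert this using 1
        field_simp
        ring
      have htp : 0 < t ^ p := Real.rpow_pos_of_pos ht p
      have hratio : (p + 1) / (1 + t) ≤ t ^ p * Real.log (1 + t) / Φ t := by
        rw [le_div_iff₀ hpos]
        calc (p + 1) / (1 + t) * Φ t ≤ (p + 1) / (1 + t) * (t ^ p * t / (p + 1)) := by gcongr
          _ = t ^ p * (t / (1 + t)) := by field_simp
          _ ≤ _ := by gcongr
      have h₁ := hratio.trans hbt
      rw [div_le_iff₀ (by linarith)] at h₁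
      have h₂ : t * (2 * (p + 1)) = p + 1 - b := div_mul_cancel₀ _ (by positivity)
      nlinarith
end
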